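/- arXiv:0812.1289 — 3 statements merged into one kernel-verified Lean document; each statement's English description precedes it below -/
import Mathlib

section
/- Let (R, m) be a commutative noetherian local ring, let a be an ideal of R, let M be a finitely generated R-module, and let n be a non-negative integer. If dim_R(H^i_a(M)) ≤ 0 (i.e. the support of H^i_a(M) is contained in {m}) for all i with 0 ≤ i ≤ n, then H^i_a(M) is artinian for all i with 0 ≤ i ≤ n; and if dim_R(H^i_a(M)) ≤ 0 for all i ≥ n, then H^i_a(M) is artinian for all i ≥ n + cd(m/a, M). -/
open CategoryTheory

/-- The cohomological dimension `cd(a, X) = sup {i | H^i_a(X) ≠ 0}` of an `R`-module `X`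
with respect to an ideal `a`. -/
noncomputable def cohDim {R : Type} [CommRing R] (a : Ideal R) (X : ModuleCat R) : ℕ :=
  sSup {i : ℕ | Nontrivial ((localCohomology a i).obj X)}

/-- For ideals `a ⊆ b`, the relative cohomological dimension
`cd(b/a, X) = inf {cd(c, X) | c an ideal of R with √b = √(c + a)}`. -/
noncomputable def cohDimRel {R : Type} [CommRing R] (a b : Ideal R) (X : ModuleCat R) : ℕ :=
  sInf {m : ℕ | ∃ c : Ideal R, b.radical = (c + a).radical ∧ cohDim c X = m}

/-- `dim_R(Y) ≤ 0`, i.e. the support of `Y` is contained in `{m}`, for a module `Y` over a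
local ring `(R, m)`. -/
def DimLEZero {R : Type} [CommRing R] [IsLocalRing R] (Y : ModuleCat R) : Prop :=
  Module.support R Y ⊆ {p | p.asIdeal = IsLocalRing.maximalIdeal R}


namespace LC
open Limits Abelian

section Compare
universe u
variable {R : Type u} [CommRing R]

/-- functor -/
noncomputable abbrev YF (Y : ModuleCat.{u} R) : ModuleCat.{u} R ⥤ (ModuleCat.{u} R)ᵒᵖ :=
  ((linearYoneda R (ModuleCat.{u} R)).obj Y).rightOp

noncomputable abbrev KC (Y : ModuleCat.{u} R) {X : ModuleCat.{u} R} (P : ProjectiveResolution X) :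
    ChainComplex (ModuleCat.{u} R)ᵒᵖ ℕ :=
  ((YF Y).mapHomologicalComplex _).obj P.complex

lemma ext_map_eq {X X' Y : ModuleCat.{u} R} (f : X' ⟶ X) (n : ℕ) :
    ((_root_.Ext R (ModuleCat.{u} R) n).map f.op).app Y = (((YF Y).leftDerived n).map f).unop := rfl

/-- cocycles -/
noncomputable abbrev ZZ (Y : ModuleCat.{u} R) {X : ModuleCat.{u} R} (P : ProjectiveResolution X)
    (n : ℕ) : ModuleCat.{u} R := ((KC Y P).opcycles n).unop

noncomputable def zi (Y : ModuleCat.{u} R) {X : ModuleCat.{u} R} (P : ProjectiveResolution X)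
    (n : ℕ) : ZZ Y P n →ₗ[R] (P.complex.X n ⟶ Y) :=
  ((KC Y P).pOpcycles n).unop.hom

noncomputable def pI (Y : ModuleCat.{u} R) {X : ModuleCat.{u} R} (P : ProjectiveResolution X)
    (n : ℕ) : ((YF Y).leftDerived n).obj X ≅ (KC Y P).homology n := P.isoLeftDerivedObj (YF Y) n

noncomputable def zr (Y : ModuleCat.{u} R) {X : ModuleCat.{u} R} (P : ProjectiveResolution X)
    (n : ℕ) : ZZ Y P n →ₗ[R] ((_root_.Ext R (ModuleCat.{u} R) n).obj (Opposite.op X)).obj Y :=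
  ((pI Y P n).hom ≫ (KC Y P).homologyι n).unop.hom

variable (Y : ModuleCat.{u} R) {X : ModuleCat.{u} R} (P : ProjectiveResolution X) (n : ℕ)

lemma zi_inj : Function.Injective (zi Y P n) := by
  have : Mono ((KC Y P).pOpcycles n).unop := inferInstance
  exact (ModuleCat.mono_iff_injective _).1 this

lemma zr_surj : Function.Surjective (zr Y P n) := by
  have : Epi ((pI Y P n).hom ≫ (KC Y P).homologyι n).unop := inferInstance
  exact (ModuleCat.epi_iff_surjective _).1 this

lemma zi_d (z : ZZ Y P n) : P.complex.d (n+1) n ≫ zi Y P n z = 0 := by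
  have h := congrArg Quiver.Hom.unop ((KC Y P).d_pOpcycles (n+1) n)
  have := congrArg (fun f => f.hom z) h
  exact this

lemma zi_exists (f : P.complex.X n ⟶ Y) (hf : P.complex.d (n+1) n ≫ f = 0) :
    ∃ z, zi Y P n z = f := by
  have hex : (ShortComplex.mk ((KC Y P).d (n+1) n) ((KC Y P).pOpcycles n)
      ((KC Y P).d_pOpcycles (n+1) n)).Exact :=
    ShortComplex.exact_of_g_is_cokernel _ ((KC Y P).opcyclesIsCokernel (n+1) n (by simp))
  have h2 := hex.unop
  rw [ShortComplex.moduleCat_exact_iff] at h2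
  exact h2 f hf

lemma zr_zero_iff (m : ℕ) (hm : (ComplexShape.down ℕ).next n = m) (z : ZZ Y P n) :
    zr Y P n z = 0 ↔ ∃ g : P.complex.X m ⟶ Y, P.complex.d n m ≫ g = zi Y P n z := by
  have hex : (ShortComplex.mk ((KC Y P).homologyι n) ((KC Y P).fromOpcycles n m)
      ((KC Y P).homologyι_comp_fromOpcycles n m)).Exact :=
    ShortComplex.exact_of_f_is_kernel _ ((KC Y P).homologyIsKernel n m hm)
  have h2 := hex.unop
  rw [ShortComplex.moduleCat_exact_iff] at h2
  have key : ∀ g : P.complex.X m ⟶ Y,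
      zi Y P n (((KC Y P).fromOpcycles n m).unop.hom g) = P.complex.d n m ≫ g := by
    intro g
    have h := congrArg Quiver.Hom.unop ((KC Y P).p_fromOpcycles n m)
    have := congrArg (fun f => f.hom g) h
    exact this
  have hz : zr Y P n z = 0 ↔ ((KC Y P).homologyι n).unop.hom z = 0 := by
    have : zr Y P n z = (pI Y P n).hom.unop.hom
      (((KC Y P).homologyι n).unop.hom z) := rfl
    rw [this]
    have hm : Mono (pI Y P n).hom.unop := inferInstance
    have hi := (ModuleCat.mono_iff_injective _).1 hm
    exact map_eq_zero_iff _ hi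
  rw [hz]
  constructor
  · intro h
    obtain ⟨g, hg⟩ := h2 z h
    refine ⟨g, (key g).symm.trans ?_⟩
    exact congrArg (zi Y P n) hg
  · rintro ⟨g, hg⟩
    rw [← key] at hg
    rw [← zi_inj _ _ _ hg]
    have h := congrArg Quiver.Hom.unop ((KC Y P).homologyι_comp_fromOpcycles n m)
    exact congrArg (fun f => f.hom g) h

lemma zr_nat {X' : ModuleCat.{u} R} (P' : ProjectiveResolution X') (f : X' ⟶ X)
    (φ : ProjectiveResolution.Hom P' P f) (z : ZZ Y P n) (z' : ZZ Y P' n)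
    (h : zi Y P' n z' = φ.hom.f n ≫ zi Y P n z) :
    ((_root_.Ext R (ModuleCat.{u} R) n).map f.op).app Y (zr Y P n z) = zr Y P' n z' := by
  let ψ := ((YF Y).mapHomologicalComplex (ComplexShape.down ℕ)).map φ.hom
  have e1 : ((YF Y).leftDerived n).map f ≫ (pI Y P n).hom = (pI Y P' n).hom ≫
      HomologicalComplex.homologyMap ψ n :=
    P'.isoLeftDerivedObj_hom_naturality f P φ.hom φ.hom_f_zero_comp_π_f_zero (YF Y) n
  have e2 : ((YF Y).leftDerived n).map f ≫ (pI Y P n).hom ≫ (KC Y P).homologyι n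
      = ((pI Y P' n).hom ≫ (KC Y P').homologyι n) ≫
        HomologicalComplex.opcyclesMap ψ n := by
    rw [← Category.assoc, e1, Category.assoc, Category.assoc,
      HomologicalComplex.homologyι_naturality ψ n]
  have e3 := congrArg (fun f => f.unop.hom z) e2
  have e4 : z' = (HomologicalComplex.opcyclesMap ψ n).unop.hom z := by
    apply zi_inj
    rw [h]
    have h := congrArg Quiver.Hom.unop (HomologicalComplex.p_opcyclesMap ψ n)
    exact (congrArg (fun f => f.hom z) h).symm
  rw [e4]
  exact e3

end Compare
end LC

namespace LC
open Limits Abelian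
section Compare2
universe u
variable {R : Type u} [CommRing R]
variable (Y : ModuleCat.{u} R) {X : ModuleCat.{u} R} (P : ProjectiveResolution X) (n : ℕ)

lemma extMk_zero_iff' (f : P.complex.X n ⟶ Y) (hf : P.complex.d (n+1) n ≫ f = 0) :
    P.extMk f (n+1) rfl hf = 0 ↔
      ∃ g : P.complex.X ((ComplexShape.down ℕ).next n) ⟶ Y, P.complex.d n _ ≫ g = f := by
  cases n with
  | succ p =>
    have : (ComplexShape.down ℕ).next (p+1) = p := by simp
    rw [this]
    exact P.extMk_eq_zero_iff f _ rfl hf p rfl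
  | zero =>
    have hd : P.complex.d 0 ((ComplexShape.down ℕ).next 0) = 0 := by
      apply P.complex.shape; simp
    rw [hd]
    simp only [zero_comp, exists_const]
    constructor
    · intro h
      rw [← P.extEquivCohomologyClass.apply_eq_iff_eq] at h
      simp only [ProjectiveResolution.extEquivCohomologyClass_extMk,
        ProjectiveResolution.extEquivCohomologyClass_zero,
        CochainComplex.HomComplex.CohomologyClass.mk_eq_zero_iff] at h
      rw [CochainComplex.HomComplex.Cocycle.toSingleMk_mem_coboundaries_iff _ _ _ _ _ 1 (by lia)] at h
      obtain ⟨g, hg⟩ := h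
      have hz : P.cochainComplex.d (-(0:ℕ)) 1 = 0 := by
        apply IsZero.eq_of_tgt
        exact P.cochainComplex.isZero_of_isStrictlyLE 0 1 (by lia)
      rw [hz, zero_comp] at hg
      exact (by simpa using hg.symm : f = 0).symm
    · rintro h
      subst h
      exact P.extMk_zero _ rfl

lemma smul_extMk (r : R) (f : P.complex.X n ⟶ Y) (hf : P.complex.d (n+1) n ≫ f = 0) :
    r • P.extMk f (n+1) rfl hf = P.extMk (r • f) (n+1) rfl (by simp [hf]) := by
  rw [Ext.smul_eq_comp_mk₀, P.extMk_comp_mk₀]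
  congr 1

/-- class -/
noncomputable def zq : ZZ Y P n →ₗ[R] Abelian.Ext X Y n where
  toFun z := P.extMk (zi Y P n z) (n+1) rfl (zi_d Y P n z)
  map_add' a b := by
    rw [P.add_extMk]; congr 1; simp
  map_smul' r a := by
    rw [RingHom.id_apply, smul_extMk]; congr 1; simp

lemma zq_surj : Function.Surjective (zq Y P n) := by
  intro e
  obtain ⟨f, hf, rfl⟩ := P.extMk_surjective e (n+1) rfl
  obtain ⟨z, rfl⟩ := zi_exists Y P n f hf
  exact ⟨z, rfl⟩

lemma ker_zr : (zr Y P n).ker = (zq Y P n).ker := by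
  ext z
  rw [LinearMap.mem_ker, LinearMap.mem_ker, zr_zero_iff Y P n _ rfl]
  exact (extMk_zero_iff' Y P n _ (zi_d Y P n z)).symm

noncomputable def eo : ((_root_.Ext R (ModuleCat.{u} R) n).obj (Opposite.op X)).obj Y ≃ₗ[R]
    Abelian.Ext X Y n :=
  ((zr Y P n).quotKerEquivOfSurjective (zr_surj Y P n)).symm ≪≫ₗ
    Submodule.quotEquivOfEq _ _ (ker_zr Y P n) ≪≫ₗ
    (zq Y P n).quotKerEquivOfSurjective (zq_surj Y P n)

lemma eo_zr (z : ZZ Y P n) : eo Y P n (zr Y P n z) = zq Y P n z := by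
  have : zr Y P n z = (zr Y P n).quotKerEquivOfSurjective (zr_surj Y P n)
    (Submodule.Quotient.mk z) := rfl
  rw [this]
  simp only [eo, LinearEquiv.trans_apply, LinearEquiv.symm_apply_apply]
  rfl

lemma eo_nat {X' : ModuleCat.{u} R} (P' : ProjectiveResolution X') (f : X' ⟶ X) 
    (x : ((_root_.Ext R (ModuleCat.{u} R) n).obj (Opposite.op X)).obj Y) :
    eo Y P' n (((_root_.Ext R (ModuleCat.{u} R) n).map f.op).app Y x) =
      (Ext.mk₀ f).comp (eo Y P n x) (zero_add n) := by
  obtain ⟨z, rfl⟩ := zr_surj Y P n x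
  have φ : ProjectiveResolution.Hom P' P f :=
    ⟨ProjectiveResolution.lift f P' P, by
      have := ProjectiveResolution.lift_commutes f P' P
      rw [← HomologicalComplex.comp_f, this]; rfl⟩
  have hd : P'.complex.d (n+1) n ≫ φ.hom.f n ≫ zi Y P n z = 0 := by
    rw [← φ.hom.comm_assoc, zi_d, comp_zero]
  obtain ⟨z', hz'⟩ := zi_exists Y P' n _ hd
  rw [zr_nat Y P n P' f φ z z' hz', eo_zr, eo_zr]
  simp only [zq, LinearMap.coe_mk, AddHom.coe_mk]
  rw [ProjectiveResolution.mk₀_comp_extMk _ _ _ _ φ]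
  congr 1
end Compare2
end LC

namespace LC
open Limits Abelian
section Model
variable {R : Type} [CommRing R]

/-- The quotient `R/a^t` as a bundled module. -/
noncomputable abbrev Q (a : Ideal R) (t : ℕ) : ModuleCat.{0} R := ModuleCat.of R (R ⧸ a ^ t)

/-- transition maps -/
noncomputable def tr (a : Ideal R) {s t : ℕ} (h : s ≤ t) : Q a t ⟶ Q a s :=
  ModuleCat.ofHom <| Submodule.mapQ _ _ LinearMap.id (Ideal.pow_le_pow_right h)

lemma tr_comp (a : Ideal R) {s t u : ℕ} (h : s ≤ t) (h' : t ≤ u) :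
    tr a h' ≫ tr a h = tr a (h.trans h') := by
  ext x
  rfl

lemma tr_refl (a : Ideal R) (s : ℕ) : tr a (le_refl s) = 𝟙 _ := by
  ext x
  rfl

/-- Ext modules -/
abbrev EX (a : Ideal R) (i : ℕ) (N : Type) [AddCommGroup N] [Module R N] (t : ℕ) : Type :=
  Abelian.Ext (Q a t) (ModuleCat.of R N) i

/-- transition maps on Ext. -/
noncomputable def etr (a : Ideal R) (i : ℕ) (N : Type) [AddCommGroup N] [Module R N]
    (s t : ℕ) (h : s ≤ t) : EX a i N s →ₗ[R] EX a i N t where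
  toFun e := (Ext.mk₀ (tr a h)).comp e (zero_add i)
  map_add' x y := by simp
  map_smul' r x := by simp

/-- The model of local cohomology. -/
abbrev G (a : Ideal R) (i : ℕ) (N : Type) [AddCommGroup N] [Module R N] : Type :=
  Module.DirectLimit (EX a i N) (etr a i N)

instance (a : Ideal R) (i : ℕ) (N : Type) [AddCommGroup N] [Module R N] :
    DirectedSystem (EX a i N) (fun s t h => etr a i N s t h) where
  map_self s x := by simp [etr, tr_refl]
  map_map s t u h h' x := by
    simp [etr]
    rw [tr_comp]

noncomputable def gof (a : Ideal R) (i : ℕ) (N : Type) [AddCommGroup N] [Module R N] (t : ℕ) :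
    EX a i N t →ₗ[R] G a i N := Module.DirectLimit.of R ℕ (EX a i N) (etr a i N) t

variable (a : Ideal R) (i : ℕ) (N : Type) [AddCommGroup N] [Module R N]

lemma gof_surj (x : G a i N) : ∃ t e, gof a i N t e = x := Module.DirectLimit.exists_of x

lemma gof_surj' (x : G a i N) (t₀ : ℕ) : ∃ t, t₀ ≤ t ∧ ∃ e, gof a i N t e = x := by
  obtain ⟨t, e, rfl⟩ := gof_surj a i N x
  exact ⟨max t t₀, le_max_right _ _, etr a i N _ _ (le_max_left _ _) e, Module.DirectLimit.of_f⟩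

lemma gof_etr {s t : ℕ} (h : s ≤ t) (e) : gof a i N t (etr a i N s t h e) = gof a i N s e :=
  Module.DirectLimit.of_f

lemma gof_zero {t : ℕ} {e} (h : gof a i N t e = 0) : ∃ s, ∃ h : t ≤ s, etr a i N t s h e = 0 :=
  Module.DirectLimit.of.zero_exact h

section equiv
variable (M : ModuleCat.{0} R)

/-- the colimit diagram -/
noncomputable abbrev Dg : ℕᵒᵖᵒᵖ ⥤ ModuleCat.{0} R :=
  localCohomology.diagram (localCohomology.idealPowersDiagram a) i ⋙
    (evaluation _ _).obj M

noncomputable def cc : Cocone (Dg a i M) :=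
  ((evaluation _ _).obj M).mapCocone
    (colimit.cocone (localCohomology.diagram (localCohomology.idealPowersDiagram a) i))

noncomputable def ccIs : IsColimit (cc a i M) :=
  isColimitOfPreserves ((evaluation _ _).obj M) (colimit.isColimit _)

lemma cc_pt : (cc a i M).pt = (localCohomology a i).obj M := rfl

noncomputable def eQ (t : ℕ) : (Dg a i M).obj (.op (.op t)) ≃ₗ[R] EX a i M t :=
  eo (ModuleCat.of R M) (projectiveResolution (Q a t)) i

lemma eQ_nat {s t : ℕ} (h : s ≤ t) (x : (Dg a i M).obj (.op (.op s))) :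
    eQ a i M t ((Dg a i M).map (homOfLE h).op.op x) = etr a i M s t h (eQ a i M s x) :=
  eo_nat (ModuleCat.of R M) (projectiveResolution (Q a s)) i (projectiveResolution (Q a t))
    (tr a h) x

noncomputable def cι (t : ℕ) : (Dg a i M).obj (.op (.op t)) →ₗ[R] (localCohomology a i).obj M :=
  ((cc a i M).ι.app (.op (.op t))).hom

lemma cι_w {s t : ℕ} (h : s ≤ t) (x : (Dg a i M).obj (.op (.op s))) :
    cι a i M t ((Dg a i M).map (homOfLE h).op.op x) = cι a i M s x :=
  congrArg (fun f => f.hom x) ((cc a i M).w (homOfLE h).op.op)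

noncomputable def ghom : G a i M →ₗ[R] (localCohomology a i).obj M :=
  Module.DirectLimit.lift R ℕ _ _ 
    (fun t => cι a i M t ∘ₗ (eQ a i M t).symm.toLinearMap)
    (by
      intro s t h e
      obtain ⟨x, rfl⟩ := (eQ a i M s).surjective e
      rw [← eQ_nat]
      rw [LinearMap.comp_apply, LinearMap.comp_apply, LinearEquiv.coe_coe, LinearEquiv.coe_coe,
        LinearEquiv.symm_apply_apply, LinearEquiv.symm_apply_apply]
      exact cι_w a i M h x)

lemma ghom_gof (t : ℕ) (x) : ghom a i M (gof a i M t (eQ a i M t x)) = cι a i M t x := by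
  refine (Module.DirectLimit.lift_of _ _ _).trans ?_
  rw [LinearMap.comp_apply, LinearEquiv.coe_coe, LinearEquiv.symm_apply_apply]

lemma ghom_bij : Function.Bijective (ghom a i M) := by
  constructor
  · rw [injective_iff_map_eq_zero]
    intro g hg
    obtain ⟨t, e, rfl⟩ := gof_surj a i M g
    obtain ⟨x, rfl⟩ := (eQ a i M t).surjective e
    rw [ghom_gof] at hg
    have h0 : (cc a i M).ι.app (.op (.op t)) x = (cc a i M).ι.app (.op (.op t)) 0 :=
      hg.trans (map_zero (cι a i M t)).symm
    have := ((ccIs a i M).eq_iff' x 0).1 h0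
    obtain ⟨j, f, hf⟩ := this
    have hle : t ≤ j.unop.unop := leOfHom f.unop.unop
    have hf' : (Dg a i M).map (homOfLE hle).op.op x = 0 := hf.trans (map_zero _)
    rw [← gof_etr a i M hle, ← eQ_nat, hf', map_zero, map_zero]
  · intro y
    obtain ⟨j, x, hx⟩ := Concrete.isColimit_exists_rep _ (ccIs a i M) y
    exact ⟨gof a i M j.unop.unop (eQ a i M _ x), (ghom_gof a i M _ x).trans hx⟩

noncomputable def gequiv : G a i M ≃ₗ[R] (localCohomology a i).obj M :=
  LinearEquiv.ofBijective _ (ghom_bij a i M)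

end equiv
end Model
end LC

namespace LC
open Limits Abelian
section API
variable {R : Type} [CommRing R] (a : Ideal R)
variable {A B C : Type} [AddCommGroup A] [Module R A] [AddCommGroup B] [Module R B]
  [AddCommGroup C] [Module R C]

noncomputable def epost (i j k : ℕ) (h : i + k = j)
    (β : Abelian.Ext (ModuleCat.of R A) (ModuleCat.of R B) k) (t : ℕ) :
    EX a i A t →ₗ[R] EX a j B t where
  toFun e := e.comp β h
  map_add' x y := by simp
  map_smul' r x := by simp

noncomputable def gpost (i j k : ℕ) (h : i + k = j)
    (β : Abelian.Ext (ModuleCat.of R A) (ModuleCat.of R B) k) : G a i A →ₗ[R] G a j B :=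
  Module.DirectLimit.map (epost a i j k h β) (by
    intro s t hst
    ext e
    simp only [LinearMap.comp_apply, epost, etr, LinearMap.coe_mk, AddHom.coe_mk]
    rw [Ext.comp_assoc (h₁₂ := zero_add i) (h₂₃ := h) (h := by omega)])

lemma gpost_gof (i j k : ℕ) (h : i + k = j)
    (β : Abelian.Ext (ModuleCat.of R A) (ModuleCat.of R B) k) (t : ℕ) (e : EX a i A t) :
    gpost a i j k h β (gof a i A t e) = gof a j B t (e.comp β h) :=
  Module.DirectLimit.map_apply_of _ _ _

lemma etr_epost (i j k : ℕ) (h : i + k = j)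
    (β : Abelian.Ext (ModuleCat.of R A) (ModuleCat.of R B) k) (s t : ℕ) (hst : s ≤ t) (e) :
    (etr a i A s t hst e).comp β h = etr a j B s t hst (e.comp β h) := by
  simp only [etr, LinearMap.coe_mk, AddHom.coe_mk]
  rw [Ext.comp_assoc (h₁₂ := zero_add i) (h₂₃ := h) (h := by omega)]

noncomputable def Gmap (i : ℕ) (f : A →ₗ[R] B) : G a i A →ₗ[R] G a i B :=
  gpost a i i 0 (add_zero i) (Ext.mk₀ (ModuleCat.ofHom f))

lemma Gmap_gof (i : ℕ) (f : A →ₗ[R] B) (t : ℕ) (e : EX a i A t) :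
    Gmap a i f (gof a i A t e) =
      gof a i B t (e.comp (Ext.mk₀ (ModuleCat.ofHom f)) (add_zero i)) :=
  gpost_gof ..

lemma Gmap_comp (i : ℕ) (f : A →ₗ[R] B) (g : B →ₗ[R] C) (x : G a i A) :
    Gmap a i g (Gmap a i f x) = Gmap a i (g ∘ₗ f) x := by
  obtain ⟨t, e, rfl⟩ := gof_surj a i A x
  rw [Gmap_gof, Gmap_gof, Gmap_gof, Ext.comp_assoc_of_third_deg_zero, Ext.mk₀_comp_mk₀]
  rfl

lemma Gmap_zero (i : ℕ) (x : G a i A) : Gmap a i (0 : A →ₗ[R] B) x = 0 := by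
  obtain ⟨t, e, rfl⟩ := gof_surj a i A x
  rw [Gmap_gof]
  have : ModuleCat.ofHom (0 : A →ₗ[R] B) = 0 := rfl
  rw [this]
  simp

lemma Gmap_smul_id (i : ℕ) (r : R) (x : G a i A) :
    Gmap a i (r • (LinearMap.id : A →ₗ[R] A)) x = r • x := by
  obtain ⟨t, e, rfl⟩ := gof_surj a i A x
  rw [Gmap_gof, ← map_smul, Ext.smul_eq_comp_mk₀]
  rfl

lemma Gmap_id (i : ℕ) (x : G a i A) : Gmap a i (LinearMap.id : A →ₗ[R] A) x = x := by
  have := Gmap_smul_id a i 1 x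
  rwa [one_smul, one_smul] at this

/-- functoriality on isomorphisms -/
noncomputable def Gcongr (i : ℕ) (e : A ≃ₗ[R] B) : G a i A ≃ₗ[R] G a i B :=
  LinearEquiv.ofLinearMap (Gmap a i e.toLinearMap) (Gmap a i e.symm.toLinearMap)
    (by refine LinearMap.ext fun x => ?_; rw [LinearMap.comp_apply, Gmap_comp]; simp [Gmap_id])
    (by refine LinearMap.ext fun x => ?_; rw [LinearMap.comp_apply, Gmap_comp]; simp [Gmap_id])

lemma G_ann (i : ℕ) (r : R) (h : ∀ y : A, r • y = 0) (x : G a i A) : r • x = 0 := by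
  rw [← Gmap_smul_id]
  have : r • (LinearMap.id : A →ₗ[R] A) = 0 := by ext y; simp [h]
  rw [this, Gmap_zero]

lemma G_sub (i : ℕ) [Subsingleton A] : Subsingleton (G a i A) := by
  refine subsingleton_of_forall_eq 0 fun x => ?_
  rw [← one_smul R x]
  exact G_ann a i 1 (fun y => Subsingleton.elim _ _) x

/-- A short exact sequence of modules -/
structure SES (f : A →ₗ[R] B) (g : B →ₗ[R] C) : Prop where
  inj : Function.Injective f
  surj : Function.Surjective g
  ex : Function.Exact f g

namespace SES
variable {f : A →ₗ[R] B} {g : B →ₗ[R] C}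

lemma short (H : SES f g) : (ShortComplex.mk (ModuleCat.ofHom f) (ModuleCat.ofHom g)
    (by ext x; exact H.ex.apply_apply_eq_zero x)).ShortExact :=
  ModuleCat.shortComplex_shortExact _ H.ex H.inj H.surj

noncomputable def δ (H : SES f g) (i : ℕ) : G a i C →ₗ[R] G a (i + 1) A :=
  gpost a i (i + 1) 1 rfl H.short.extClass

lemma ex₂ (H : SES f g) (i : ℕ) : Function.Exact (Gmap a i f) (Gmap a i g) := by
  intro x
  constructor
  · intro hx
    obtain ⟨t, e, rfl⟩ := gof_surj a i B x
    rw [Gmap_gof] at hx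
    obtain ⟨s, hs, h0⟩ := gof_zero a i C hx
    rw [← etr_epost] at h0
    obtain ⟨e', he'⟩ := Ext.covariant_sequence_exact₂ _ H.short _ h0
    refine ⟨gof a i A s e', ?_⟩
    rw [Gmap_gof, ← gof_etr a i B hs, ← he']
  · rintro ⟨y, rfl⟩
    rw [Gmap_comp, H.ex.linearMap_comp_eq_zero, Gmap_zero]

lemma ex₃ (H : SES f g) (i : ℕ) : Function.Exact (Gmap a i g) (H.δ a i) := by
  intro x
  constructor
  · intro hx
    obtain ⟨t, e, rfl⟩ := gof_surj a i C x
    rw [δ, gpost_gof] at hx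
    obtain ⟨s, hs, h0⟩ := gof_zero a _ A hx
    rw [← etr_epost] at h0
    obtain ⟨e', he'⟩ := Ext.covariant_sequence_exact₃ _ H.short _ _ h0
    refine ⟨gof a i B s e', ?_⟩
    rw [Gmap_gof, ← gof_etr a i C hs, ← he']
  · rintro ⟨y, rfl⟩
    obtain ⟨t, e, rfl⟩ := gof_surj a i B y
    rw [Gmap_gof, δ, gpost_gof, Ext.comp_assoc_of_second_deg_zero]
    have := H.short.comp_extClass
    dsimp at this
    rw [this]
    simp

lemma ex₁ (H : SES f g) (i : ℕ) : Function.Exact (H.δ a i) (Gmap a (i + 1) f) := by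
  intro x
  constructor
  · intro hx
    obtain ⟨t, e, rfl⟩ := gof_surj a _ A x
    rw [Gmap_gof] at hx
    obtain ⟨s, hs, h0⟩ := gof_zero a _ B hx
    rw [← etr_epost] at h0
    obtain ⟨e', he'⟩ := Ext.covariant_sequence_exact₁ _ H.short _ h0 rfl
    refine ⟨gof a i C s e', ?_⟩
    rw [δ, gpost_gof, ← gof_etr a _ A hs, ← he']
  · rintro ⟨y, rfl⟩
    obtain ⟨t, e, rfl⟩ := gof_surj a i C y
    rw [δ, gpost_gof, Gmap_gof, Ext.comp_assoc_of_third_deg_zero]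
    have := H.short.extClass_comp
    dsimp at this
    rw [this]
    simp

end SES

lemma G_inj (i : ℕ) (h : Injective (ModuleCat.of R A)) : Subsingleton (G a (i + 1) A) := by
  refine subsingleton_of_forall_eq 0 fun x => ?_
  obtain ⟨t, e, rfl⟩ := gof_surj a _ A x
  rw [Ext.eq_zero_of_injective e, map_zero]

lemma G_tors (i : ℕ) (x : G a i A) : ∃ t, ∀ r ∈ a ^ t, r • x = 0 := by
  obtain ⟨t, e, rfl⟩ := gof_surj a _ A x
  refine ⟨t, fun r hr => ?_⟩
  have h1 : r • 𝟙 (Q a t) = 0 := by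
    ext
    change r • (Submodule.Quotient.mk 1 : R ⧸ a ^ t) = 0
    rw [← Submodule.Quotient.mk_smul, Submodule.Quotient.mk_eq_zero]
    simpa using hr
  have h2 : r • e = 0 := by
    rw [← Ext.mk₀_id_comp e, ← Ext.smul_comp, ← Ext.mk₀_smul, h1]
    simp
  rw [← map_smul, h2, map_zero]

/-- the torsion submodule -/
def Gam (A : Type) [AddCommGroup A] [Module R A] : Submodule R A where
  carrier := {y | ∃ t, ∀ r ∈ a ^ t, r • y = 0}
  zero_mem' := ⟨0, by simp⟩
  add_mem' := by
    rintro x y ⟨s, hs⟩ ⟨t, ht⟩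
    refine ⟨max s t, fun r hr => ?_⟩
    rw [smul_add, hs r (Ideal.pow_le_pow_right (le_max_left _ _) hr),
      ht r (Ideal.pow_le_pow_right (le_max_right _ _) hr), add_zero]
  smul_mem' := by
    rintro c x ⟨s, hs⟩
    exact ⟨s, fun r hr => by rw [smul_comm, hs r hr, smul_zero]⟩

lemma mem_Gam {y : A} : y ∈ Gam a A ↔ ∃ t, ∀ r ∈ a ^ t, r • y = 0 := Iff.rfl

/-- evaluation at one. -/
noncomputable def ev1 (t : ℕ) : EX a 0 A t →ₗ[R] A where
  toFun e := (Ext.linearEquiv₀ (R := R) e).hom (Submodule.Quotient.mk 1)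
  map_add' x y := by simp
  map_smul' r x := by simp

noncomputable def g0 : G a 0 A →ₗ[R] A :=
  Module.DirectLimit.lift R ℕ _ _ (ev1 a) (by
    intro s t h e
    obtain ⟨f, rfl⟩ := (Ext.linearEquiv₀ (R := R)).symm.surjective e
    simp only [ev1, etr, LinearMap.coe_mk, AddHom.coe_mk, Ext.linearEquiv₀_symm_apply]
    rw [Ext.mk₀_comp_mk₀]
    rw [← Ext.linearEquiv₀_symm_apply (R := R), ← Ext.linearEquiv₀_symm_apply (R := R)]
    rw [LinearEquiv.apply_symm_apply, LinearEquiv.apply_symm_apply]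
    rfl)

lemma g0_gof (t : ℕ) (f : Q a t ⟶ ModuleCat.of R A) :
    g0 a (gof a 0 A t (Ext.mk₀ f)) = f.hom (Submodule.Quotient.mk 1) := by
  refine (Module.DirectLimit.lift_of _ _ _).trans ?_
  simp only [ev1, LinearMap.coe_mk, AddHom.coe_mk]
  rw [← Ext.linearEquiv₀_symm_apply (R := R), LinearEquiv.apply_symm_apply]

lemma g0_inj : Function.Injective (g0 a (A := A)) := by
  rw [injective_iff_map_eq_zero]
  intro x hx
  obtain ⟨t, e, rfl⟩ := gof_surj a _ A x
  obtain ⟨f, rfl⟩ := (Ext.linearEquiv₀ (R := R)).symm.surjective e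
  rw [Ext.linearEquiv₀_symm_apply] at hx ⊢
  rw [g0_gof] at hx
  have : f = 0 := by
    ext
    exact hx
  rw [this]
  simp

lemma g0_nat (f : A →ₗ[R] B) (x : G a 0 A) : g0 a (Gmap a 0 f x) = f (g0 a x) := by
  obtain ⟨t, e, rfl⟩ := gof_surj a _ A x
  obtain ⟨p, rfl⟩ := (Ext.linearEquiv₀ (R := R)).symm.surjective e
  rw [Ext.linearEquiv₀_symm_apply, Gmap_gof, Ext.mk₀_comp_mk₀, g0_gof, g0_gof]
  rfl

lemma g0_range : LinearMap.range (g0 a (A := A)) = Gam a A := by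
  ext y
  constructor
  · rintro ⟨x, rfl⟩
    obtain ⟨t, ht⟩ := G_tors a 0 x
    exact ⟨t, fun r hr => by rw [← map_smul, ht r hr, map_zero]⟩
  · rintro ⟨t, ht⟩
    refine ⟨gof a 0 A t (Ext.mk₀ (ModuleCat.ofHom
      (Submodule.liftQ (a ^ t) (LinearMap.toSpanSingleton R A y) ?_))), ?_⟩
    · intro r hr
      simpa using ht r hr
    · rw [g0_gof]
      refine (Submodule.liftQ_apply _ _ _).trans ?_
      simp

end API
end LC

namespace LC
open Limits Abelian
section Inj
variable {R : Type} [CommRing R] (a : Ideal R)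
variable {A B C : Type} [AddCommGroup A] [Module R A] [AddCommGroup B] [Module R B]
  [AddCommGroup C] [Module R C]

lemma SES.ofSub (K : Submodule R B) : SES K.subtype K.mkQ :=
  ⟨K.injective_subtype, K.mkQ_surjective, by
    rw [LinearMap.exact_iff]; simp⟩

lemma SES.ofInj (f : A →ₗ[R] B) (h : Function.Injective f) : SES f (LinearMap.range f).mkQ :=
  ⟨h, Submodule.mkQ_surjective _, by rw [LinearMap.exact_iff]; simp⟩

lemma SES.ofSurj (g : B →ₗ[R] C) (h : Function.Surjective g) : SES (LinearMap.ker g).subtype g :=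
  ⟨Submodule.injective_subtype _, h, by rw [LinearMap.exact_iff]; simp⟩

section
variable {f : A →ₗ[R] B} {g : B →ₗ[R] C}

lemma SES.sub_mid (H : SES f g) (i : ℕ) (h1 : Subsingleton (G a i A)) (h2 : Subsingleton (G a i C)) :
    Subsingleton (G a i B) := by
  refine subsingleton_of_forall_eq 0 fun x => ?_
  obtain ⟨y, rfl⟩ := (H.ex₂ a i x).1 (Subsingleton.elim _ _)
  rw [Subsingleton.elim y 0, map_zero]

lemma SES.sub_left (H : SES f g) (i : ℕ) (h1 : Subsingleton (G a i C)) (h2 : Subsingleton (G a (i + 1) B)) :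
    Subsingleton (G a (i + 1) A) := by
  refine subsingleton_of_forall_eq 0 fun x => ?_
  obtain ⟨y, rfl⟩ := (H.ex₁ a i x).1 (Subsingleton.elim _ _)
  rw [Subsingleton.elim y 0, map_zero]

lemma SES.sub_right (H : SES f g) (i : ℕ) (h1 : Subsingleton (G a i B)) (h2 : Subsingleton (G a (i + 1) A)) :
    Subsingleton (G a i C) := by
  refine subsingleton_of_forall_eq 0 fun x => ?_
  obtain ⟨y, rfl⟩ := (H.ex₃ a i x).1 (Subsingleton.elim _ _)
  rw [Subsingleton.elim y 0, map_zero]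

lemma SES.δ_surj (H : SES f g) (i : ℕ) (h : Subsingleton (G a (i + 1) B)) : Function.Surjective (H.δ a i) :=
  fun x => (H.ex₁ a i x).1 (Subsingleton.elim _ _)

lemma SES.δ_inj (H : SES f g) (i : ℕ) (h : Subsingleton (G a i B)) : Function.Injective (H.δ a i) := by
  rw [injective_iff_map_eq_zero]
  intro x hx
  obtain ⟨y, rfl⟩ := (H.ex₃ a i x).1 hx
  rw [Subsingleton.elim y 0, map_zero]

end

lemma exists_inj (N : Type) [AddCommGroup N] [Module R N] :
    ∃ (E : Type) (_ : AddCommGroup E) (_ : Module R E) (f : N →ₗ[R] E),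
      Function.Injective f ∧ Module.Injective R E := by
  obtain ⟨p⟩ := EnoughInjectives.presentation (ModuleCat.of R N)
  refine ⟨p.J, inferInstance, inferInstance, p.f.hom, ?_, ?_⟩
  · exact (ModuleCat.mono_iff_injective p.f).1 p.mono
  · exact (Module.injective_iff_injective_object R p.J).2 p.injective

lemma G_Inj (E : Type) [AddCommGroup E] [Module R E] (h : Module.Injective R E) (i : ℕ) :
    Subsingleton (G a (i + 1) E) :=
  G_inj a i ((Module.injective_iff_injective_object R E).1 h)

lemma Gam_pow_fg [IsNoetherianRing R] (N : Type) [AddCommGroup N] [Module R N]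
    [Module.Finite R N] (h : ∀ y : N, y ∈ Gam a N) : ∃ t, ∀ r ∈ a ^ t, ∀ y : N, r • y = 0 := by
  obtain ⟨S, hS⟩ := (Module.Finite.fg_top : (⊤ : Submodule R N).FG)
  choose t ht using h
  refine ⟨S.sup t, fun r hr y => ?_⟩
  have : y ∈ Submodule.span R (S : Set N) := by rw [hS]; trivial
  induction this using Submodule.span_induction with
  | mem x hx =>
    exact ht x r (Ideal.pow_le_pow_right (Finset.le_sup (f := t) hx) hr)
  | zero => simp
  | add x y _ _ hx hy => rw [smul_add, hx, hy, add_zero]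
  | smul c x _ hx => rw [smul_comm, hx, smul_zero]

lemma Gam_injective [IsNoetherianRing R] (E : Type) [AddCommGroup E] [Module R E]
    (h : Module.Injective R E) : Module.Injective R (Gam a E) := by
  apply Module.Baer.injective
  intro I g
  obtain ⟨t, ht⟩ : ∃ t, ∀ r ∈ a ^ t, ∀ y : I, r • g y = 0 := by
    have := Gam_pow_fg a (LinearMap.range g) (by
      rintro ⟨⟨y, s, hs⟩, hy⟩
      refine ⟨s, fun r hr => ?_⟩
      ext
      exact hs r hr)
    obtain ⟨t, ht⟩ := this
    refine ⟨t, fun r hr y => ?_⟩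
    have := ht r hr ⟨g y, y, rfl⟩
    exact congrArg Subtype.val this
  obtain ⟨k, hk⟩ := a.exists_pow_inf_eq_pow_smul (I : Submodule R R)
  have hk := hk (t + k) (by omega)
  simp only [add_tsub_cancel_right] at hk
  let s := t + k
  have hg : ∀ y : I, (y : R) ∈ a ^ s → g y = 0 := by
    rintro ⟨y, hy⟩ hys
    have h1 : y ∈ a ^ t • (I : Submodule R R) := by
      have : y ∈ (a ^ s • (⊤ : Submodule R R) ⊓ I) := ⟨by simpa using hys, hy⟩
      rw [hk] at this
      exact Submodule.smul_mono le_rfl inf_le_right this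
    have key : ∀ z ∈ a ^ t • (I : Submodule R R), ∃ hz : z ∈ I, g ⟨z, hz⟩ = 0 := by
      intro z hz
      refine Submodule.smul_induction_on hz ?_ ?_
      · intro r hr n hn
        refine ⟨I.mul_mem_left r hn, ?_⟩
        have := ht r hr ⟨n, hn⟩
        rw [← map_smul] at this
        exact this
      · intro x y hx hy
        obtain ⟨hx, hx'⟩ := hx
        obtain ⟨hy, hy'⟩ := hy
        refine ⟨I.add_mem hx hy, ?_⟩
        have : (⟨x + y, I.add_mem hx hy⟩ : I) = ⟨x, hx⟩ + ⟨y, hy⟩ := rfl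
        rw [this, map_add, hx', hy', add_zero]
    exact (key y h1).2
  let φ : I →ₗ[R] R ⧸ a ^ s := (Submodule.mkQ (a ^ s)).comp (Submodule.subtype I)
  have hker : LinearMap.ker φ ≤ LinearMap.ker g := by
    intro y hy
    refine hg y ?_
    exact (Submodule.Quotient.mk_eq_zero _).1 hy
  obtain ⟨h', hh'⟩ := h.out (LinearMap.ker φ |>.liftQ φ le_rfl)
    (LinearMap.ker_eq_bot.1 (Submodule.ker_liftQ_eq_bot _ _ _ le_rfl))
    ((Gam a E).subtype ∘ₗ (LinearMap.ker φ).liftQ g hker)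
  refine ⟨LinearMap.codRestrict (Gam a E) (h' ∘ₗ Submodule.mkQ (a ^ s)) ?_, ?_⟩
  · intro c
    refine ⟨s, fun r hr => ?_⟩
    rw [← map_smul]
    have : Submodule.mkQ (a ^ s) (r • c) = 0 :=
      (Submodule.Quotient.mk_eq_zero _).2 (Ideal.mul_mem_right c _ hr)
    rw [LinearMap.comp_apply, this, map_zero]
  · intro x hx
    ext
    have := hh' (Submodule.Quotient.mk ⟨x, hx⟩)
    exact this

lemma Gam_map (f : A →ₗ[R] B) {y : A} (hy : y ∈ Gam a A) : f y ∈ Gam a B := by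
  obtain ⟨t, ht⟩ := hy
  exact ⟨t, fun r hr => by rw [← map_smul, ht r hr, map_zero]⟩

lemma Gam_of_inj (f : A →ₗ[R] B) (hf : Function.Injective f) {y : A} (hy : f y ∈ Gam a B) :
    y ∈ Gam a A := by
  obtain ⟨t, ht⟩ := hy
  exact ⟨t, fun r hr => hf (by rw [map_smul, ht r hr, map_zero])⟩

lemma Gam_Gam (y : Gam a A) : y ∈ Gam a (Gam a A) :=
  Gam_of_inj a (Gam a A).subtype (Submodule.injective_subtype _) y.2

lemma g0_mem (x : G a 0 A) : g0 a x ∈ Gam a A := by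
  rw [← g0_range]; exact ⟨x, rfl⟩

lemma exists_g0 {y : A} (hy : y ∈ Gam a A) : ∃ x, g0 a x = y := by
  rwa [← g0_range] at hy

/-- Higher local cohomology of torsion modules vanishes. -/
lemma G_of_tors [IsNoetherianRing R] (i : ℕ) : ∀ (N : Type) [AddCommGroup N] [Module R N],
    (∀ y : N, y ∈ Gam a N) → Subsingleton (G a (i + 1) N) := by
  induction i with
  | zero =>
    intro N _ _ h
    obtain ⟨E, _, _, f, hf, hE⟩ := exists_inj (R := R) N
    let f' : N →ₗ[R] Gam a E := f.codRestrict _ (fun y => Gam_map a f (h y))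
    have hf' : Function.Injective f' := fun x y hxy => hf (congrArg Subtype.val hxy)
    have H := SES.ofInj f' hf'
    have := G_Inj a _ (Gam_injective a E hE) 0
    refine subsingleton_of_forall_eq 0 fun x => ?_
    obtain ⟨y, rfl⟩ := H.δ_surj a 0 this x
    refine (H.ex₃ a 0 y).2 ?_
    obtain ⟨z, hz⟩ := H.surj (g0 a y)
    obtain ⟨w, rfl⟩ := exists_g0 a (Gam_Gam a z)
    exact ⟨w, g0_inj a (by rw [g0_nat, hz])⟩
  | succ i ih =>
    intro N _ _ h
    obtain ⟨E, _, _, f, hf, hE⟩ := exists_inj (R := R) N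
    let f' : N →ₗ[R] Gam a E := f.codRestrict _ (fun y => Gam_map a f (h y))
    have hf' : Function.Injective f' := fun x y hxy => hf (congrArg Subtype.val hxy)
    have H := SES.ofInj f' hf'
    have := G_Inj a _ (Gam_injective a E hE) (i + 1)
    refine H.sub_left a _ (ih _ ?_) this
    intro y
    obtain ⟨z, rfl⟩ := H.surj y
    exact Gam_map a _ (Gam_Gam a z)

end Inj
end LC

namespace LC
section Alg
variable {R : Type} [CommRing R]
variable {A B C : Type} [AddCommGroup A] [Module R A] [AddCommGroup B] [Module R B]
  [AddCommGroup C] [Module R C]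

lemma mem_Gam_iff [IsNoetherianRing R] (c : Ideal R) {y : A} :
    y ∈ Gam c A ↔ ∀ x ∈ c, ∃ k : ℕ, x ^ k • y = 0 := by
  constructor
  · rintro ⟨t, ht⟩ x hx
    exact ⟨t, ht _ (Ideal.pow_mem_pow hx t)⟩
  · intro h
    have h1 : c ≤ Ideal.radical (LinearMap.ker (LinearMap.toSpanSingleton R A y)) := by
      intro x hx
      obtain ⟨k, hk⟩ := h x hx
      exact ⟨k, by simpa using hk⟩
    obtain ⟨t, ht⟩ := Ideal.exists_pow_le_of_le_radical_of_fg h1 (IsNoetherian.noetherian c)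
    exact ⟨t, fun r hr => by simpa using ht hr⟩

lemma pow_kill {x : R} {y : A} {k l : ℕ} (h : x ^ k • y = 0) (hl : k ≤ l) : x ^ l • y = 0 := by
  obtain ⟨m, rfl⟩ := Nat.exists_eq_add_of_le hl
  rw [add_comm, pow_add, mul_smul, h, smul_zero]

lemma Gam_radical [IsNoetherianRing R] (c d : Ideal R) (h : d ≤ c.radical) :
    Gam c A ≤ Gam d A := by
  intro y hy
  rw [mem_Gam_iff] at hy ⊢
  intro x hx
  obtain ⟨k, hk⟩ := h hx
  obtain ⟨l, hl⟩ := hy _ hk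
  exact ⟨k * l, by rw [pow_mul, hl]⟩

lemma Gam_sup [IsNoetherianRing R] (c d : Ideal R) {y : A} :
    y ∈ Gam (c + d) A ↔ y ∈ Gam c A ∧ y ∈ Gam d A := by
  constructor
  · intro h
    exact ⟨Gam_radical _ _ (le_sup_left.trans Ideal.le_radical) h,
      Gam_radical _ _ (le_sup_right.trans Ideal.le_radical) h⟩
  · rintro ⟨h1, h2⟩
    rw [mem_Gam_iff] at h1 h2 ⊢
    have hle : c + d ≤ Ideal.radical (LinearMap.ker (LinearMap.toSpanSingleton R A y)) := by
      refine sup_le ?_ ?_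
      · intro x hx
        obtain ⟨k, hk⟩ := h1 x hx
        exact ⟨k, by simpa using hk⟩
      · intro x hx
        obtain ⟨k, hk⟩ := h2 x hx
        exact ⟨k, by simpa using hk⟩
    intro x hx
    obtain ⟨k, hk⟩ := hle hx
    exact ⟨k, by simpa using hk⟩

lemma Gam_ext [IsNoetherianRing R] (c : Ideal R) (f : A →ₗ[R] B) (g : B →ₗ[R] C)
    (h : Function.Exact f g) (hA : ∀ y : A, y ∈ Gam c A) (hC : ∀ y : C, y ∈ Gam c C) (y : B) :
    y ∈ Gam c B := by
  rw [mem_Gam_iff]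
  intro x hx
  obtain ⟨k, hk⟩ := (mem_Gam_iff c).1 (hC (g y)) x hx
  rw [← map_smul] at hk
  obtain ⟨z, hz⟩ := (h _).1 hk
  obtain ⟨l, hl⟩ := (mem_Gam_iff c).1 (hA z) x hx
  exact ⟨l + k, by rw [pow_add, mul_smul, ← hz, ← map_smul, hl, map_zero]⟩

lemma artin_of_ker (x : R) (hx : ∀ y : A, ∃ k : ℕ, x ^ k • y = 0)
    (h : IsArtinian R (LinearMap.ker (x • (LinearMap.id : A →ₗ[R] A)))) : IsArtinian R A := by
  rw [← monotone_stabilizes_iff_artinian]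
  intro F
  let N : ℕ → Submodule R A := fun j => OrderDual.ofDual (F j)
  have hN : ∀ i j, i ≤ j → N j ≤ N i := fun i j hij => F.monotone hij
  let T := LinearMap.ker (x • (LinearMap.id : A →ₗ[R] A))
  let P : ℕ → ℕ → Submodule R T := fun t j =>
    (Submodule.map (x ^ t • (LinearMap.id : A →ₗ[R] A)) (N j)).comap T.subtype
  have hP : ∀ t t' j j', t ≤ t' → j ≤ j' → P t' j' ≤ P t j := by
    rintro t t' j j' ht hj ⟨z, hz⟩ ⟨w, hw, hw'⟩
    refine ⟨x ^ (t' - t) • w, (N j).smul_mem _ (hN _ _ hj hw), ?_⟩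
    simp only [LinearMap.smul_apply, LinearMap.id_apply] at hw' ⊢
    rw [← mul_smul, ← pow_add, Nat.add_sub_cancel' ht, hw']
  obtain ⟨_, ⟨⟨t0, j0⟩, rfl⟩, hmin⟩ := IsArtinian.set_has_minimal
    (Set.range fun p : ℕ × ℕ => P p.1 p.2) ⟨_, (0, 0), rfl⟩
  have hst : ∀ t j, t0 ≤ t → j0 ≤ j → P t j = P t0 j0 := fun t j ht hj =>
    (eq_or_lt_of_le (hP _ _ _ _ ht hj)).resolve_right (hmin _ ⟨(t, j), rfl⟩)
  have hs1 : ∀ t, ∃ m, ∀ j, m ≤ j → P t m = P t j := fun t =>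
    IsArtinian.monotone_stabilizes
      ⟨fun j => OrderDual.toDual (P t j), fun i j hij => hP _ _ _ _ le_rfl hij⟩
  choose m hm using hs1
  let J := max j0 ((Finset.range t0).sup m)
  have hJ : ∀ t j, J ≤ j → P t J ≤ P t j := by
    intro t j hj
    by_cases ht : t0 ≤ t
    · rw [hst t j ht ((le_max_left _ _).trans hj), hst t J ht (le_max_left _ _)]
    · have h1 : m t ≤ J := (Finset.le_sup (f := m) (Finset.mem_range.2 (not_le.1 ht))).trans
        (le_max_right _ _)
      rw [← hm t J h1, ← hm t j (h1.trans hj)]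
  refine ⟨J, fun j hj => ?_⟩
  change N J = N j
  refine le_antisymm ?_ (hN _ _ hj)
  have key : ∀ k : ℕ, ∀ y ∈ N J, x ^ k • y = 0 → y ∈ N j := by
    intro k
    induction k with
    | zero => intro y _ h; rw [pow_zero, one_smul] at h; rw [h]; exact zero_mem _
    | succ k ih =>
      intro y hy h
      have hz : x ^ k • y ∈ T := by
        change x • (x ^ k • y) = 0
        rw [← mul_smul, ← pow_succ', h]
      have : (⟨x ^ k • y, hz⟩ : T) ∈ P k J := ⟨y, hy, rfl⟩
      obtain ⟨w, hw, hw'⟩ := hJ k j hj this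
      have h2 : x ^ k • w = x ^ k • y := hw'
      have h3 := ih (y - w) (sub_mem hy (hN _ _ hj hw)) (by rw [smul_sub, h2, sub_self])
      have := add_mem h3 hw
      rwa [sub_add_cancel] at this
  intro y hy
  obtain ⟨k, hk⟩ := hx y
  exact key k y hy hk

variable [IsNoetherianRing R] [IsLocalRing R]
open IsLocalRing

lemma artin_of_pow (t : ℕ) : ∀ (N : Type) [AddCommGroup N] [Module R N] [Module.Finite R N],
    (∀ r ∈ maximalIdeal R ^ t, ∀ y : N, r • y = 0) → IsArtinian R N := by
  induction t with
  | zero =>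
    intro N _ _ _ h
    have : Subsingleton N := subsingleton_of_forall_eq 0 fun y => by
      rw [← one_smul R y]; exact h 1 (by simp) y
    infer_instance
  | succ t ih =>
    intro N _ _ _ h
    rw [isArtinian_iff_submodule_quotient (maximalIdeal R • (⊤ : Submodule R N))]
    constructor
    · refine ih _ ?_
      rintro r hr ⟨y, hy⟩
      ext
      change r • y = 0
      refine Submodule.smul_induction_on hy ?_ ?_
      · intro s hs n _
        rw [← mul_smul]
        exact h _ (by rw [pow_succ]; exact Ideal.mul_mem_mul hr hs) n
      · intro x y hx hy
        rw [smul_add, hx, hy, add_zero]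
    · let _ : Field (R ⧸ maximalIdeal R) := Ideal.Quotient.field _
      have : Module.Finite (R ⧸ maximalIdeal R) (N ⧸ maximalIdeal R • (⊤ : Submodule R N)) :=
        Module.Finite.of_restrictScalars_finite R _ _
      have : IsArtinian (R ⧸ maximalIdeal R) (N ⧸ maximalIdeal R • (⊤ : Submodule R N)) :=
        inferInstance
      exact isArtinian_of_surjective_algebraMap (R := R ⧸ maximalIdeal R)
        (Ideal.Quotient.mk_surjective)

lemma artin_of_fg (N : Type) [AddCommGroup N] [Module R N] [Module.Finite R N]
    (h : ∀ y : N, y ∈ Gam (maximalIdeal R) N) : IsArtinian R N := by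
  obtain ⟨t, ht⟩ := Gam_pow_fg _ N h
  exact artin_of_pow t N ht

variable (a : Ideal R)

lemma G0_artin (M : Type) [AddCommGroup M] [Module R M] [Module.Finite R M]
    (h : ∀ y : G a 0 M, y ∈ Gam (maximalIdeal R) (G a 0 M)) : IsArtinian R (G a 0 M) := by
  have : Module.Finite R (G a 0 M) := Module.Finite.of_injective (g0 a) (g0_inj a)
  exact artin_of_fg _ h

lemma Gam_quot (M : Type) [AddCommGroup M] [Module R M] [Module.Finite R M]
    (y : M ⧸ Gam a M) (hy : y ∈ Gam a (M ⧸ Gam a M)) : y = 0 := by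
  obtain ⟨z, rfl⟩ := Submodule.mkQ_surjective _ y
  rw [Submodule.mkQ_apply, Submodule.Quotient.mk_eq_zero]
  rw [mem_Gam_iff] at hy ⊢
  intro x hx
  obtain ⟨k, hk⟩ := hy x hx
  rw [← map_smul, Submodule.mkQ_apply, Submodule.Quotient.mk_eq_zero, mem_Gam_iff] at hk
  obtain ⟨l, hl⟩ := hk x hx
  exact ⟨l + k, by rw [pow_add, mul_smul, hl]⟩

lemma part1 (n : ℕ) : ∀ (M : Type) [AddCommGroup M] [Module R M] [Module.Finite R M],
    (∀ i, i ≤ n → ∀ y : G a i M, y ∈ Gam (maximalIdeal R) (G a i M)) →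
    ∀ i, i ≤ n → IsArtinian R (G a i M) := by
  induction n with
  | zero =>
    intro M _ _ _ h i hi
    obtain rfl : i = 0 := by omega
    exact G0_artin a M (h 0 le_rfl)
  | succ n ih =>
    intro M _ _ _ h i hi
    obtain _ | j := i
    · exact G0_artin a M (h 0 (by omega))
    have H := SES.ofSub (Gam a M)
    have hz : ∀ i, Subsingleton (G a (i + 1) (Gam a M)) :=
      fun i => G_of_tors a i _ (Gam_Gam a)
    have hbij : ∀ i, Function.Bijective (Gmap a (i + 1) (Gam a M).mkQ) := by
      intro i
      constructor
      · rw [injective_iff_map_eq_zero]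
        intro x hx
        obtain ⟨y, rfl⟩ := (H.ex₂ a (i + 1) x).1 hx
        have := hz i
        rw [Subsingleton.elim y 0, map_zero]
      · intro x
        have := hz (i + 1)
        exact (H.ex₃ a (i + 1) x).1 (Subsingleton.elim _ _)
    let M' := M ⧸ Gam a M
    have h' : ∀ i, i ≤ n + 1 → ∀ y : G a i M', y ∈ Gam (maximalIdeal R) (G a i M') := by
      intro i hi y
      obtain _ | i := i
      · have : g0 a y = 0 := Gam_quot a M _ (g0_mem a y)
        rw [g0_inj a (this.trans (map_zero _).symm)]
        exact zero_mem _
      · obtain ⟨z, rfl⟩ := (hbij i).2 y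
        exact Gam_map _ _ (h _ hi z)
    obtain ⟨x, hxa, hx⟩ : ∃ x ∈ a, IsSMulRegular M' x := by
      have := (IsSMulRegular.subsingleton_linearMap_iff (R := R) (N := R ⧸ a) (M := M')).1 (by
        refine subsingleton_of_forall_eq 0 fun f => ?_
        ext
        refine Gam_quot a M _ ⟨1, fun r hr => ?_⟩
        rw [← map_smul]
        have : r • (a.mkQ 1) = 0 := by
          rw [← map_smul, Submodule.mkQ_apply, Submodule.Quotient.mk_eq_zero]
          rw [pow_one] at hr
          simpa using hr
        exact (congrArg f this).trans (map_zero f))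
      rwa [Ideal.annihilator_quotient] at this
    let mx : M' →ₗ[R] M' := x • LinearMap.id
    have Hx := SES.ofInj mx (fun u v huv => hx huv)
    have hq : ∀ i, i ≤ n → IsArtinian R (G a i (M' ⧸ LinearMap.range mx)) := by
      refine ih (M' ⧸ LinearMap.range mx) ?_
      intro i hi
      exact Gam_ext _ _ _ (Hx.ex₃ a i) (h' i (by omega)) (h' (i + 1) (by omega))
    have hart : IsArtinian R (G a (j + 1) M') := by
      refine artin_of_ker x ?_ ?_
      · intro y
        exact (mem_Gam_iff a).1 (G_tors a _ y) x hxa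
      · have e : LinearMap.ker (x • (LinearMap.id : G a (j + 1) M' →ₗ[R] G a (j + 1) M')) =
            LinearMap.range (Hx.δ a j) := by
          ext y
          have h1 := Hx.ex₁ a j y
          rw [Gmap_smul_id] at h1
          exact h1
        rw [e]
        have := hq j (by omega)
        infer_instance
    exact isArtinian_of_injective _ (hbij j).1

/-- local cohomology at an ideal with radical the maximal ideal is artinian. -/
lemma artin_m (b : Ideal R) (hb : maximalIdeal R ≤ b.radical) (M : Type) [AddCommGroup M]
    [Module R M] [Module.Finite R M] (i : ℕ) : IsArtinian R (G b i M) :=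
  part1 b i M (fun j _ y => Gam_radical b _ hb (G_tors b j y)) i le_rfl

end Alg
end LC

namespace LC
open Abelian
section CD
variable {R : Type} [CommRing R] [IsNoetherianRing R]

lemma ext_fg (i : ℕ) : ∀ (X N : Type) [AddCommGroup X] [Module R X] [Module.Finite R X]
    [AddCommGroup N] [Module R N] (e : Abelian.Ext (ModuleCat.of R X) (ModuleCat.of R N) i),
    ∃ (N' : Submodule R N) (_ : N'.FG)
      (e' : Abelian.Ext (ModuleCat.of R X) (ModuleCat.of R N') i),
      e'.comp (Ext.mk₀ (ModuleCat.ofHom N'.subtype)) (add_zero i) = e := by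
  induction i with
  | zero =>
    intro X N _ _ _ _ _ e
    obtain ⟨f, rfl⟩ := (Ext.linearEquiv₀ (R := R)).symm.surjective e
    refine ⟨LinearMap.range f.hom, ?_,
      Ext.mk₀ (ModuleCat.ofHom (LinearMap.rangeRestrict f.hom)), ?_⟩
    · rw [LinearMap.range_eq_map]
      exact Module.Finite.fg_top.map _
    · rw [Ext.mk₀_comp_mk₀, Ext.linearEquiv₀_symm_apply]
      rfl
  | succ i ih =>
    intro X N _ _ _ _ _ e
    obtain ⟨n, p, hp⟩ := Module.Finite.exists_fin' R X
    have H := SES.ofSurj p hp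
    have : Projective (ModuleCat.of R (Fin n → R)) :=
      (IsProjective.iff_projective _).1 inferInstance
    obtain ⟨e1, he1⟩ := Ext.contravariant_sequence_exact₃ H.short _ e
      (Ext.eq_zero_of_projective _) (add_comm 1 i)
    obtain ⟨N', hN', e', he'⟩ := ih (LinearMap.ker p) N e1
    refine ⟨N', hN', H.short.extClass.comp e' (add_comm 1 i), ?_⟩
    rw [Ext.comp_assoc_of_third_deg_zero, he', he1]

lemma G_fg (c : Ideal R) (i : ℕ) (N : Type) [AddCommGroup N] [Module R N]
    (h : ∀ N' : Submodule R N, N'.FG → Subsingleton (G c i N')) : Subsingleton (G c i N) := by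
  refine subsingleton_of_forall_eq 0 fun x => ?_
  obtain ⟨t, e, rfl⟩ := gof_surj c i N x
  obtain ⟨N', hN', e', he'⟩ := ext_fg i (R ⧸ c ^ t) N e
  have := h N' hN'
  rw [← he', ← Gmap_gof, Subsingleton.elim (gof c i N' t e') 0, map_zero]

lemma cosyz (k : ℕ) : ∀ (N : Type) [AddCommGroup N] [Module R N],
    ∃ (W : Type) (_ : AddCommGroup W) (_ : Module R W), ∀ (c : Ideal R) (j : ℕ),
      Subsingleton (G c (j + 1) W) ↔ Subsingleton (G c (j + 1 + k) N) := by
  induction k with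
  | zero => exact fun N _ _ => ⟨N, _, _, fun c j => Iff.rfl⟩
  | succ k ih =>
    intro N _ _
    obtain ⟨E, _, _, f, hf, hE⟩ := exists_inj (R := R) N
    have H := SES.ofInj f hf
    obtain ⟨W, _, _, hW⟩ := ih (E ⧸ LinearMap.range f)
    refine ⟨W, _, _, fun c j => (hW c j).trans ?_⟩
    have e : j + 1 + k = j + k + 1 := by omega
    have e' : j + 1 + (k + 1) = j + k + 1 + 1 := by omega
    rw [e, e']
    constructor
    · intro h
      exact H.sub_left c _ h (G_Inj c E hE _)
    · intro h
      exact H.sub_right c _ (G_Inj c E hE _) h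

lemma inj_div (I : Type) [AddCommGroup I] [Module R I] (hI : Module.Injective R I) (x : R)
    (e : I) (m : ℕ) : ∃ (e' : I) (l : ℕ), x ^ l • (e - x ^ m • e') = 0 := by
  let F : ℕ →o Ideal R := ⟨fun l => LinearMap.ker (LinearMap.mulLeft R (x ^ l)), by
    intro i j hij r hr
    simp only [LinearMap.mem_ker, LinearMap.mulLeft_apply] at hr ⊢
    exact pow_kill (R := R) (A := R) (x := x) (y := r) hr hij⟩
  obtain ⟨l, hl⟩ := monotone_stabilizes_iff_noetherian.2 (inferInstance : IsNoetherian R R) F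
  have hl := hl (l + m) (by omega)
  let f := LinearMap.mulLeft R (x ^ (l + m))
  obtain ⟨h, hh⟩ := hI.out ((LinearMap.ker f).liftQ f le_rfl)
    (LinearMap.ker_eq_bot.1 (Submodule.ker_liftQ_eq_bot _ _ _ le_rfl))
    ((LinearMap.ker f).liftQ (LinearMap.toSpanSingleton R I (x ^ l • e)) (by
      intro r hr
      change r ∈ F (l + m) at hr
      rw [← hl] at hr
      have hr : x ^ l * r = 0 := hr
      rw [LinearMap.mem_ker, LinearMap.toSpanSingleton_apply, ← mul_smul, mul_comm, hr, zero_smul]))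
  refine ⟨h 1, l, ?_⟩
  have := hh (Submodule.Quotient.mk 1)
  rw [Submodule.liftQ_apply, Submodule.liftQ_apply, LinearMap.toSpanSingleton_apply, one_smul] at this
  have h3 : f 1 = x ^ (l + m) • (1 : R) := by simp [f]
  rw [h3, map_smul] at this
  rw [smul_sub, ← mul_smul, ← pow_add, this, sub_self]

lemma Gam_surj (c : Ideal R) {A B C : Type} [AddCommGroup A] [Module R A] [AddCommGroup B]
    [Module R B] [AddCommGroup C] [Module R C] {f : A →ₗ[R] B} {g : B →ₗ[R] C} (H : SES f g)
    (h : Subsingleton (G c 1 A)) {y : C} (hy : y ∈ Gam c C) : ∃ z ∈ Gam c B, g z = y := by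
  obtain ⟨u, rfl⟩ := exists_g0 c hy
  obtain ⟨v, rfl⟩ := (H.ex₃ c 0 u).1 (Subsingleton.elim _ _)
  exact ⟨g0 c v, g0_mem c v, (g0_nat c g v).symm⟩

lemma G_one_of_surj (c : Ideal R) {A B C : Type} [AddCommGroup A] [Module R A] [AddCommGroup B]
    [Module R B] [AddCommGroup C] [Module R C] {f : A →ₗ[R] B} {g : B →ₗ[R] C} (H : SES f g)
    (hB : Subsingleton (G c 1 B))
    (h : ∀ y ∈ Gam c C, ∃ z ∈ Gam c B, g z = y) : Subsingleton (G c 1 A) := by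
  refine subsingleton_of_forall_eq 0 fun x => ?_
  obtain ⟨u, rfl⟩ := H.δ_surj c 0 hB x
  refine (H.ex₃ c 0 u).2 ?_
  obtain ⟨z, hz, hz'⟩ := h _ (g0_mem c u)
  obtain ⟨v, rfl⟩ := exists_g0 c hz
  exact ⟨v, g0_inj c (by rw [g0_nat, hz'])⟩

lemma G2_step (c : Ideal R) (x : R) (W : Type) [AddCommGroup W] [Module R W]
    (h : ∀ j, Subsingleton (G c (j + 1) W)) : Subsingleton (G (c + Ideal.span {x}) 2 W) := by
  obtain ⟨E, _, _, f, hf, hE⟩ := exists_inj (R := R) W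
  have H := SES.ofInj f hf
  obtain ⟨E', _, _, f', hf', hE'⟩ := exists_inj (R := R) (E ⧸ LinearMap.range f)
  have H' := SES.ofInj f' hf'
  have h1 : Subsingleton (G c 1 (E ⧸ LinearMap.range f)) := H.sub_right c _ (G_Inj c E hE _) (h 1)
  refine H.sub_left _ 1 ?_ (G_Inj _ E hE _)
  refine G_one_of_surj _ H' (G_Inj _ E' hE' _) ?_
  intro y hy
  rw [Gam_sup] at hy
  obtain ⟨e, he, rfl⟩ := Gam_surj c H' h1 hy.1
  obtain ⟨k, hk⟩ := (mem_Gam_iff _).1 hy.2 x (Ideal.mem_span_singleton_self x)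
  rw [← map_smul] at hk
  obtain ⟨w, hw⟩ := (H'.ex _).1 hk
  have hwc : w ∈ Gam c (E ⧸ LinearMap.range f) :=
    Gam_of_inj c f' hf' (by rw [hw]; exact Submodule.smul_mem _ _ he)
  obtain ⟨u, hu, rfl⟩ := Gam_surj c H (h 0) hwc
  obtain ⟨⟨u', hu'⟩, l, hl⟩ := inj_div _ (Gam_injective c E hE) x ⟨u, hu⟩ k
  have hl : x ^ l • (u - x ^ k • u') = 0 := congrArg Subtype.val hl
  refine ⟨e - f' ((LinearMap.range f).mkQ u'), ?_, ?_⟩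
  · rw [Gam_sup]
    constructor
    · exact sub_mem he (Gam_map _ _ (Gam_map _ _ hu'))
    · rw [mem_Gam_iff]
      intro r hr
      obtain ⟨s, rfl⟩ := Ideal.mem_span_singleton'.1 hr
      refine ⟨l + k, ?_⟩
      have : x ^ (l + k) • (e - f' ((LinearMap.range f).mkQ u')) = 0 := by
        rw [pow_add, mul_smul, smul_sub, ← hw, ← map_smul, ← map_smul, ← map_sub, ← map_sub,
          ← map_smul, ← map_smul, hl, map_zero, map_zero]
      rw [mul_pow, mul_smul, this, smul_zero]
  · rw [map_sub, H'.ex.apply_apply_eq_zero, sub_zero]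

lemma cd_bound (c : Ideal R) : ∃ r : ℕ, ∀ i, r < i → ∀ (N : Type) [AddCommGroup N] [Module R N],
    Subsingleton (G c i N) := by
  classical
  obtain ⟨S, rfl⟩ := IsNoetherian.noetherian c
  induction S using Finset.induction_on with
  | empty =>
    refine ⟨0, fun i hi N _ _ => ?_⟩
    obtain ⟨i, rfl⟩ := Nat.exists_eq_succ_of_ne_zero hi.ne'
    refine G_of_tors _ i N fun y => ⟨1, fun r hr => ?_⟩
    have : r = 0 := by simpa using hr
    rw [this, zero_smul]
  | insert x S hx ih =>
    obtain ⟨r, hr⟩ := ih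
    refine ⟨r + 1, fun i hi N _ _ => ?_⟩
    have e : Submodule.span R ((insert x S : Finset R) : Set R) =
        Submodule.span R (S : Set R) + Ideal.span {x} := by
      rw [Finset.coe_insert, Submodule.span_insert, sup_comm]
      rfl
    rw [e]
    obtain ⟨W, _, _, hW⟩ := cosyz (R := R) (i - 2) N
    have h2 := G2_step (Submodule.span R (S : Set R)) x W (fun j => by
      rw [hW]
      exact hr _ (by omega) N)
    have := (hW _ 1).1 h2
    have e2 : 1 + 1 + (i - 2) = i := by omega
    rwa [e2] at this

end CD
end LC

namespace LC
section CDC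
variable {R : Type} [CommRing R] [IsNoetherianRing R]

lemma prime_map (M : Type) [AddCommGroup M] [Module R M] [Module.Finite R M] (J : Ideal R)
    (hJ : J.IsPrime) (h : Module.annihilator R M ≤ J) : ∃ f : M →ₗ[R] R ⧸ J, f ≠ 0 := by
  let S : Set (Submodule R M) := {K | J • ⊤ ≤ K ∧ ∀ s, s ∉ J → ∃ y, s • y ∉ K}
  have hS : S.Nonempty := by
    refine ⟨J • ⊤, le_rfl, fun s hs => ?_⟩
    by_contra! hc
    have h1 : (⟨J, hJ⟩ : PrimeSpectrum R) ∈ Module.support R (M ⧸ (J • ⊤ : Submodule R M)) := by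
      rw [Module.support_quotient]
      exact ⟨Module.mem_support_iff_of_finite.2 h, fun x hx => hx⟩
    rw [Module.mem_support_iff_of_finite] at h1
    refine hs (h1 ?_)
    rw [Module.mem_annihilator]
    intro y
    obtain ⟨z, rfl⟩ := Submodule.mkQ_surjective _ y
    rw [← map_smul, Submodule.mkQ_apply, Submodule.Quotient.mk_eq_zero]
    exact hc z
  obtain ⟨K, ⟨hK1, hK2⟩, hmax⟩ :=
    set_has_maximal_iff_noetherian.2 (inferInstance : IsNoetherian R M) S hS
  obtain ⟨y, hy⟩ := hK2 1 ((Ideal.ne_top_iff_one J).1 hJ.ne_top)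
  rw [one_smul] at hy
  have hlt : K < K ⊔ R ∙ y := by
    refine lt_of_le_of_ne le_sup_left fun e => hy ?_
    rw [e]
    exact Submodule.mem_sup_right (Submodule.mem_span_singleton_self y)
  have hn : K ⊔ R ∙ y ∉ S := fun hc => hmax _ hc hlt
  obtain ⟨s, hs, hs'⟩ : ∃ s, s ∉ J ∧ ∀ z, s • z ∈ K ⊔ R ∙ y := by
    by_contra! hc
    exact hn ⟨hK1.trans le_sup_left, hc⟩
  -- the map `R → M/K`, `1 ↦ y`, has kernel `J`
  let φ : R →ₗ[R] M ⧸ K := LinearMap.toSpanSingleton R _ (K.mkQ y)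
  have hφ : ∀ r, φ r = 0 ↔ r ∈ J := by
    intro r
    have e : φ r = 0 ↔ r • y ∈ K := by
      simp only [φ, LinearMap.toSpanSingleton_apply]
      rw [← map_smul, Submodule.mkQ_apply, Submodule.Quotient.mk_eq_zero]
    rw [e]
    constructor
    · intro hr
      by_contra hrJ
      obtain ⟨z, hz⟩ := hK2 (r * s) (fun hc => (hJ.mem_or_mem hc).elim hrJ hs)
      refine hz ?_
      obtain ⟨k, hk, u, hu, e⟩ := Submodule.mem_sup.1 (hs' z)
      obtain ⟨v, rfl⟩ := Submodule.mem_span_singleton.1 hu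
      rw [mul_smul, ← e, smul_add, smul_comm r v]
      exact add_mem (K.smul_mem _ hk) (K.smul_mem _ hr)
    · intro hr
      exact hK1 (Submodule.smul_mem_smul hr trivial)
  let ψ : (R ⧸ J) →ₗ[R] M ⧸ K := Submodule.liftQ J φ (fun r hr => (hφ r).2 hr)
  have hψ : Function.Injective ψ := by
    rw [injective_iff_map_eq_zero]
    intro r hr
    obtain ⟨r, rfl⟩ := Submodule.mkQ_surjective _ r
    rw [Submodule.mkQ_apply, Submodule.Quotient.mk_eq_zero]
    exact (hφ r).1 hr
  let θ : M →ₗ[R] M ⧸ K := s • K.mkQ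
  have hθ : ∀ z, θ z ∈ LinearMap.range ψ := by
    intro z
    obtain ⟨k, hk, u, hu, e⟩ := Submodule.mem_sup.1 (hs' z)
    obtain ⟨v, rfl⟩ := Submodule.mem_span_singleton.1 hu
    refine ⟨J.mkQ v, ?_⟩
    have : θ z = K.mkQ (s • z) := by simp [θ]
    rw [this, ← e, map_add, map_smul]
    have hk0 : K.mkQ k = 0 := by simpa using hk
    rw [hk0, zero_add]
    rfl
  let f : M →ₗ[R] R ⧸ J := (LinearEquiv.ofInjective ψ hψ).symm.toLinearMap ∘ₗ
    θ.codRestrict (LinearMap.range ψ) hθ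
  refine ⟨f, fun hf => ?_⟩
  obtain ⟨z, hz⟩ := hK2 s hs
  have h0 : f z = 0 := by rw [hf]; rfl
  have h1 : θ.codRestrict (LinearMap.range ψ) hθ z = 0 :=
    (LinearEquiv.ofInjective ψ hψ).symm.map_eq_zero_iff.1 h0
  have h2 : θ z = 0 := congrArg Subtype.val h1
  have h3 : θ z = K.mkQ (s • z) := by simp [θ]
  rw [h3, Submodule.mkQ_apply, Submodule.Quotient.mk_eq_zero] at h2
  exact hz h2

variable (c : Ideal R) (M : Type) [AddCommGroup M] [Module R M] [Module.Finite R M]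

lemma cd_step (i : ℕ)
    (hR : ∀ (N : Type) [AddCommGroup N] [Module R N],
      Module.annihilator R M ≤ Module.annihilator R N → Subsingleton (G c (i + 1) N))
    (hM : Subsingleton (G c i M)) (J : Ideal R) :
    Module.annihilator R M ≤ J → ∀ (N : Type) [AddCommGroup N] [Module R N] [Module.Finite R N],
      J ≤ Module.annihilator R N → Subsingleton (G c i N) := by
  have rex : ∀ (B C : Type) [AddCommGroup B] [Module R B] [AddCommGroup C] [Module R C]
      (g : B →ₗ[R] C), Function.Surjective g → Module.annihilator R M ≤ Module.annihilator R B →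
      Subsingleton (G c i B) → Subsingleton (G c i C) := by
    intro B C _ _ _ _ g hg hann hB
    refine (SES.ofSurj g hg).sub_right c i hB (hR _ (hann.trans ?_))
    exact LinearMap.annihilator_le_of_injective (LinearMap.ker g).subtype
      (Submodule.injective_subtype _)
  induction J using WellFoundedGT.induction with
  | ind J ih =>
    intro hJM N _ _ _ hJN
    by_cases hJ : J.IsPrime
    · have hRJ : Subsingleton (G c i (R ⧸ J)) := by
        obtain ⟨f, hf⟩ := prime_map M J hJ hJM
        refine (SES.ofSub (LinearMap.range f)).sub_mid c i ?_ ?_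
        · exact rex M _ f.rangeRestrict f.surjective_rangeRestrict le_rfl hM
        · have hle : J ≤ Submodule.comap J.mkQ (LinearMap.range f) := by
            intro r hr
            rw [Submodule.mem_comap]
            have : J.mkQ r = 0 := by simpa [Ideal.Quotient.eq_zero_iff_mem] using hr
            rw [this]
            exact zero_mem _
          refine ih (Submodule.comap J.mkQ (LinearMap.range f)) ?_ (hJM.trans hle) _ ?_
          · refine lt_of_le_of_ne hle fun e => hf ?_
            ext z
            obtain ⟨r, hr⟩ := Submodule.mkQ_surjective J (f z)
            have : r ∈ J := by
              rw [e, Submodule.mem_comap, hr]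
              exact ⟨z, rfl⟩
            rw [← hr]
            simpa [Ideal.Quotient.eq_zero_iff_mem] using this
          · intro r hr
            rw [Module.mem_annihilator]
            intro y
            obtain ⟨y, rfl⟩ := Submodule.mkQ_surjective _ y
            obtain ⟨q, rfl⟩ := Submodule.mkQ_surjective _ y
            rw [← map_smul, ← map_smul, Submodule.mkQ_apply, Submodule.Quotient.mk_eq_zero,
              smul_eq_mul, mul_comm, ← smul_eq_mul, map_smul]
            exact Submodule.smul_mem _ _ hr
      have hall : ∀ (K : Submodule R N), K.FG → Subsingleton (G c i K) := by
        intro K hK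
        refine Submodule.fg_induction (motive := fun K _ => Subsingleton (G c i K)) ?_ ?_ K hK
        · intro x
          refine rex (R ⧸ J) _ (J.liftQ (LinearMap.toSpanSingleton R (R ∙ x)
            ⟨x, Submodule.mem_span_singleton_self x⟩) ?_) ?_ ?_ hRJ
          · intro r hr
            rw [LinearMap.mem_ker, LinearMap.toSpanSingleton_apply]
            ext
            exact Module.mem_annihilator.1 (hJN hr) x
          · rintro ⟨y, hy⟩
            obtain ⟨r, rfl⟩ := Submodule.mem_span_singleton.1 hy
            exact ⟨J.mkQ r, rfl⟩
          · rw [Ideal.annihilator_quotient]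
            exact hJM
        · intro N₁ N₂ _ _ h1 h2
          have hp : Subsingleton (G c i (N₁ × N₂)) := by
            refine SES.sub_mid (f := LinearMap.inl R N₁ N₂) (g := LinearMap.snd R N₁ N₂) c
              ⟨LinearMap.inl_injective, LinearMap.snd_surjective, ?_⟩ i h1 h2
            exact Function.Exact.inl_snd
          refine rex (N₁ × N₂) _ (LinearMap.coprod (Submodule.inclusion le_sup_left)
            (Submodule.inclusion le_sup_right)) ?_ ?_ hp
          · rintro ⟨y, hy⟩
            obtain ⟨u, hu, v, hv, rfl⟩ := Submodule.mem_sup.1 hy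
            exact ⟨(⟨u, hu⟩, ⟨v, hv⟩), by ext; simp⟩
          · intro r hr
            rw [Module.mem_annihilator]
            rintro ⟨⟨u, hu⟩, ⟨v, hv⟩⟩
            have := Module.mem_annihilator.1 (hJN (hJM hr))
            ext
            · exact this u
            · exact this v
      exact G_fg c i N hall
    · by_cases htop : J = ⊤
      · have : Subsingleton N := subsingleton_of_forall_eq 0 fun y => by
          rw [← one_smul R y]
          exact Module.mem_annihilator.1 (hJN (by rw [htop]; trivial)) y
        exact G_sub c i
      obtain ⟨x, y, hxy, hx, hy⟩ : ∃ x y, x * y ∈ J ∧ x ∉ J ∧ y ∉ J := by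
        by_contra! hc
        exact hJ ⟨htop, fun {x y} h => or_iff_not_imp_left.2 fun hx => hc x y h hx⟩
      have hlt : ∀ z, z ∉ J → J < J ⊔ Ideal.span {z} := by
        intro z hz
        refine lt_of_le_of_ne le_sup_left fun e => hz ?_
        rw [e]
        exact Ideal.mem_sup_right (Ideal.mem_span_singleton_self z)
      let mx : N →ₗ[R] N := x • LinearMap.id
      refine (SES.ofSub (LinearMap.range mx)).sub_mid c i ?_ ?_
      · refine ih _ (hlt y hy) (hJM.trans le_sup_left) _ (sup_le ?_ ?_)
        · exact hJN.trans (LinearMap.annihilator_le_of_injective (LinearMap.range mx).subtype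
            (Submodule.injective_subtype _))
        · rw [Ideal.span_singleton_le_iff_mem, Module.mem_annihilator]
          rintro ⟨_, z, rfl⟩
          ext
          change y • (x • z) = 0
          rw [← mul_smul, mul_comm]
          exact Module.mem_annihilator.1 (hJN hxy) z
      · refine ih _ (hlt x hx) (hJM.trans le_sup_left) _ (sup_le ?_ ?_)
        · exact hJN.trans (LinearMap.annihilator_le_of_surjective _ (Submodule.mkQ_surjective _))
        · rw [Ideal.span_singleton_le_iff_mem, Module.mem_annihilator]
          intro z
          obtain ⟨z, rfl⟩ := Submodule.mkQ_surjective _ z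
          rw [← map_smul, Submodule.mkQ_apply, Submodule.Quotient.mk_eq_zero]
          exact ⟨z, rfl⟩

lemma cd_compare (d : ℕ) (hM : ∀ i, d < i → Subsingleton (G c i M)) :
    ∀ i, d < i → ∀ (N : Type) [AddCommGroup N] [Module R N],
      Module.annihilator R M ≤ Module.annihilator R N → Subsingleton (G c i N) := by
  obtain ⟨r, hr⟩ := cd_bound c
  have key : ∀ k i, d < i → r < i + k → ∀ (N : Type) [AddCommGroup N] [Module R N],
      Module.annihilator R M ≤ Module.annihilator R N → Subsingleton (G c i N) := by
    intro k
    induction k with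
    | zero => exact fun i _ h N _ _ _ => hr i h N
    | succ k ih =>
      intro i hi h N _ _ hN
      refine G_fg c i N fun N' hN' => ?_
      have : Module.Finite R N' := Module.Finite.iff_fg.2 hN'
      refine cd_step c M i (fun N _ _ => ih (i + 1) (by omega) (by omega) N) (hM i hi)
        (Module.annihilator R M) le_rfl N' (hN.trans ?_)
      exact LinearMap.annihilator_le_of_injective N'.subtype (Submodule.injective_subtype _)
  exact fun i hi => key (r + 1) i hi (by omega)

end CDC
end LC

namespace LC
section Part2
variable {R : Type} [CommRing R] [IsNoetherianRing R]
variable {A B C : Type} [AddCommGroup A] [Module R A] [AddCommGroup B] [Module R B]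
  [AddCommGroup C] [Module R C] {f : A →ₗ[R] B} {g : B →ₗ[R] C}

noncomputable def g0e (b : Ideal R) (A : Type) [AddCommGroup A] [Module R A] :
    G b 0 A ≃ₗ[R] Gam b A :=
  (LinearEquiv.ofInjective (g0 b (A := A)) (g0_inj b)).trans (LinearEquiv.ofEq _ _ (g0_range b))

lemma g0e_val (b : Ideal R) (x : G b 0 A) : (g0e b A x : A) = g0 b x := rfl

noncomputable def SES.kap (H : SES f g) (b : Ideal R) : Gam b C →ₗ[R] G b 1 A :=
  H.δ b 0 ∘ₗ (g0e b C).symm.toLinearMap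

lemma SES.kap_surj (H : SES f g) (b : Ideal R) (h : Subsingleton (G b 1 B)) :
    Function.Surjective (H.kap b) :=
  (H.δ_surj b 0 h).comp (g0e b C).symm.surjective

lemma SES.kap_zero (H : SES f g) (b : Ideal R) (y : Gam b C) :
    H.kap b y = 0 ↔ ∃ e ∈ Gam b B, g e = y := by
  refine (H.ex₃ b 0 _).trans ?_
  constructor
  · rintro ⟨v, hv⟩
    refine ⟨g0 b v, g0_mem b v, ?_⟩
    rw [← g0_nat, hv, ← g0e_val]
    simp
  · rintro ⟨e, he, h⟩
    obtain ⟨v, rfl⟩ := exists_g0 b he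
    refine ⟨v, ?_⟩
    refine (g0e b C).injective ?_
    ext
    rw [g0e_val, g0_nat, h]
    simp

/-- restriction of a map to torsion -/
def Gres (b : Ideal R) (g : B →ₗ[R] C) : Gam b B →ₗ[R] Gam b C :=
  g.restrict (fun _ hx => Gam_map b g hx)

lemma Gres_val (b : Ideal R) (g : B →ₗ[R] C) (x : Gam b B) : (Gres b g x : C) = g x := rfl

lemma kap_ker (H : SES f g) (b c : Ideal R) (hE : Module.Injective R B) (s : ℕ)
    (h : Subsingleton (G c (s + 2) (Gam b A))) :
    Subsingleton (G c (s + 1) (LinearMap.ker (H.kap b))) := by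
  let g' : Gam b B →ₗ[R] LinearMap.ker (H.kap b) :=
    (Gres b g).codRestrict _ (fun x => (H.kap_zero b _).2 ⟨x, x.2, rfl⟩)
  have hval : ∀ x, ((g' x : Gam b C) : C) = g x := fun _ => rfl
  have H' : SES (Gres b f) g' := by
    refine ⟨?_, ?_, ?_⟩
    · intro x y hxy
      exact Subtype.ext (H.inj (congrArg Subtype.val hxy))
    · rintro ⟨y, hy⟩
      obtain ⟨e, he, h⟩ := (H.kap_zero b y).1 hy
      exact ⟨⟨e, he⟩, Subtype.ext (Subtype.ext h)⟩
    · intro x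
      constructor
      · intro hx
        have hx : g x = 0 := by rw [← hval, hx]; rfl
        obtain ⟨u, hu⟩ := (H.ex _).1 hx
        exact ⟨⟨u, Gam_of_inj b f H.inj (by rw [hu]; exact x.2)⟩, Subtype.ext hu⟩
      · rintro ⟨u, rfl⟩
        exact Subtype.ext (Subtype.ext (H.ex.apply_apply_eq_zero _))
  exact H'.sub_right c _ (G_Inj c _ (Gam_injective b B hE) _) h

lemma part2_chain (a c : Ideal R) (M : Type) [AddCommGroup M] [Module R M] (k : ℕ)
    (hV : ∀ q s, k ≤ q + s → Subsingleton (G c (s + 1) (G a q M))) (q : ℕ) :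
    ∃ (N : Type) (_ : AddCommGroup N) (_ : Module R N),
      (∀ (b : Ideal R) (i : ℕ), Nonempty (G b (i + 1) N ≃ₗ[R] G b (i + 1 + q) M)) ∧
      ∀ s, k ≤ q + s → Subsingleton (G c (s + 1) (Gam a N)) := by
  induction q with
  | zero =>
    refine ⟨M, _, _, fun b i => ⟨LinearEquiv.refl _ _⟩, fun s hs => ?_⟩
    have := hV 0 s hs
    exact (Gcongr c (s + 1) (g0e a M)).symm.toEquiv.subsingleton
  | succ q ih =>
    obtain ⟨N, _, _, hN1, hN2⟩ := ih
    obtain ⟨E, _, _, f, hf, hE⟩ := exists_inj (R := R) N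
    have H := SES.ofInj f hf
    refine ⟨E ⧸ LinearMap.range f, inferInstance, inferInstance, fun b i => ?_, fun s hs => ?_⟩
    · obtain ⟨e⟩ := hN1 b (i + 1)
      have h1 : i + 1 + (q + 1) = i + 1 + 1 + q := by omega
      rw [h1]
      exact ⟨(LinearEquiv.ofBijective (H.δ b (i + 1))
        ⟨H.δ_inj b _ (G_Inj b E hE _), H.δ_surj b _ (G_Inj b E hE _)⟩).trans e⟩
    · refine (SES.ofSurj (H.kap a) (H.kap_surj a (G_Inj a E hE _))).sub_mid c _ ?_ ?_
      · exact kap_ker H a c hE s (hN2 (s + 1) (by omega))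
      · obtain ⟨e⟩ := hN1 a 0
        have h1 : 0 + 1 + q = q + 1 := by omega
        rw [h1] at e
        have := hV (q + 1) s hs
        exact (Gcongr c (s + 1) e).toEquiv.subsingleton

lemma part2 [IsLocalRing R] (a c : Ideal R)
    (hca : (c + a).radical = IsLocalRing.maximalIdeal R)
    (M : Type) [AddCommGroup M] [Module R M] [Module.Finite R M] (n d : ℕ)
    (hd : ∀ i, d < i → Subsingleton (G c i M))
    (hn : ∀ i, n ≤ i → ∀ y : G a i M, y ∈ Gam (IsLocalRing.maximalIdeal R) (G a i M))
    (i : ℕ) (hi : n + d ≤ i) : IsArtinian R (G a i M) := by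
  have hcm : c ≤ (IsLocalRing.maximalIdeal R).radical := by
    have : c ≤ IsLocalRing.maximalIdeal R := by
      rw [← hca]
      exact (le_sup_left : c ≤ c ⊔ a).trans Ideal.le_radical
    exact this.trans Ideal.le_radical
  rcases i with _ | q
  · refine part1 a 0 M (fun i hi0 y => hn i (by omega) y) 0 le_rfl
  have hV : ∀ q s, n + d ≤ q + s → Subsingleton (G c (s + 1) (G a q M)) := by
    intro q s hqs
    by_cases hq : n ≤ q
    · exact G_of_tors c s _ fun y => Gam_radical _ c hcm (hn q hq y)
    · refine cd_compare c M d hd (s + 1) (by omega) _ fun r hr => ?_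
      rw [Module.mem_annihilator] at hr ⊢
      exact G_ann a q r hr
  obtain ⟨N, _, _, hN1, hN2⟩ := part2_chain a c M (n + d) hV q
  obtain ⟨E, _, _, f, hf, hE⟩ := exists_inj (R := R) N
  have H := SES.ofInj f hf
  obtain ⟨e⟩ := hN1 a 0
  obtain ⟨e'⟩ := hN1 (c + a) 0
  have h1 : 0 + 1 + q = q + 1 := by omega
  rw [h1] at e e'
  have hart : IsArtinian R (G (c + a) 1 N) := by
    have := artin_m (c + a) hca.ge M (q + 1)
    exact (LinearEquiv.isArtinian_iff e').2 this
  suffices hs : IsArtinian R (G a 1 N) from (LinearEquiv.isArtinian_iff e).1 hs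
  have hK := kap_ker H a c hE 0 (hN2 1 (by omega))
  have hle : Gam (c + a) (E ⧸ LinearMap.range f) ≤ Gam a (E ⧸ LinearMap.range f) :=
    fun y hy => ((Gam_sup c a).1 hy).2
  let φ : Gam (c + a) (E ⧸ LinearMap.range f) →ₗ[R] G a 1 N :=
    H.kap a ∘ₗ Submodule.inclusion hle
  have hφ : Function.Surjective φ := by
    intro y
    have hy : y ∈ Gam c (G a 1 N) := by
      refine Gam_of_inj c e.toLinearMap e.injective ?_
      exact Gam_radical _ c hcm (hn (q + 1) (by omega) _)
    obtain ⟨z, hz, hzy⟩ := Gam_surj c (SES.ofSurj (H.kap a) (H.kap_surj a (G_Inj a E hE _))) hK hy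
    refine ⟨⟨z, (Gam_sup c a).2 ⟨Gam_map c (Submodule.subtype _) hz, z.2⟩⟩, hzy⟩
  let ψ := H.kap (c + a)
  have hψ : Function.Surjective ψ := H.kap_surj _ (G_Inj _ E hE _)
  have hker : LinearMap.ker ψ ≤ LinearMap.ker φ := by
    intro y hy
    obtain ⟨u, hu, huy⟩ := (H.kap_zero (c + a) y).1 hy
    exact (H.kap_zero a _).2 ⟨u, ((Gam_sup c a).1 hu).2, huy⟩
  have hq : IsArtinian R (Gam (c + a) (E ⧸ LinearMap.range f) ⧸ LinearMap.ker ψ) :=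
    (LinearEquiv.isArtinian_iff (ψ.quotKerEquivOfSurjective hψ)).2 hart
  refine isArtinian_of_surjective _ ((LinearMap.ker ψ).liftQ φ hker) ?_
  intro y
  obtain ⟨z, rfl⟩ := hφ y
  exact ⟨Submodule.Quotient.mk z, rfl⟩

lemma dim_tors [IsLocalRing R] (Y : Type) [AddCommGroup Y] [Module R Y]
    (h : Module.support R Y ⊆ {p | p.asIdeal = IsLocalRing.maximalIdeal R}) (y : Y) :
    y ∈ Gam (IsLocalRing.maximalIdeal R) Y := by
  have hle : IsLocalRing.maximalIdeal R ≤ Ideal.radical (LinearMap.ker (LinearMap.toSpanSingleton R Y y)) := by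
    rw [Ideal.radical_eq_sInf]
    refine le_sInf ?_
    rintro J ⟨hJ, hJp⟩
    have : (⟨J, hJp⟩ : PrimeSpectrum R) ∈ Module.support R Y := by
      rw [Module.mem_support_iff_exists_annihilator]
      refine ⟨y, fun r hr => hJ ?_⟩
      rw [Submodule.mem_annihilator_span_singleton] at hr
      exact hr
    exact (h this).ge
  rw [mem_Gam_iff]
  intro x hx
  obtain ⟨k, hk⟩ := hle hx
  exact ⟨k, hk⟩

end Part2
end LC

open LC

/-- Let `(R, m)` be a commutative noetherian local ring, `a` an ideal of `R`,
`M` a finitely generated `R`-module and `n ≥ 0`.  If `dim_R(H^i_a(M)) ≤ 0` for all `0 ≤ i ≤ n`,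
then `H^i_a(M)` is artinian for all `0 ≤ i ≤ n`; and if `dim_R(H^i_a(M)) ≤ 0` for all `i ≥ n`,
then `H^i_a(M)` is artinian for all `i ≥ n + cd(m/a, M)`. -/
theorem statement13 {R : Type} [CommRing R] [IsNoetherianRing R] [IsLocalRing R]
    (a : Ideal R) (M : ModuleCat R) [Module.Finite R M] (n : ℕ) :
    ((∀ i, i ≤ n → DimLEZero ((localCohomology a i).obj M)) →
      ∀ i, i ≤ n → IsArtinian R ((localCohomology a i).obj M)) ∧
    ((∀ i, n ≤ i → DimLEZero ((localCohomology a i).obj M)) →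
      ∀ i, n + cohDimRel a (IsLocalRing.maximalIdeal R) M ≤ i →
        IsArtinian R ((localCohomology a i).obj M)) := by
  have htr : ∀ i, DimLEZero ((localCohomology a i).obj M) →
      ∀ y : G a i M, y ∈ Gam (IsLocalRing.maximalIdeal R) (G a i M) := by
    intro i h y
    exact Gam_of_inj _ (gequiv a i M).toLinearMap (gequiv a i M).injective (dim_tors _ h _)
  constructor
  · intro h i hi
    refine (LinearEquiv.isArtinian_iff (gequiv a i M)).1 ?_
    exact part1 a n M (fun i hi => htr i (h i hi)) i hi
  · intro h i hi
    refine (LinearEquiv.isArtinian_iff (gequiv a i M)).1 ?_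
    by_cases hat : a = ⊤
    · have : Subsingleton (G a i M) := subsingleton_of_forall_eq 0 fun x => by
        obtain ⟨t, ht⟩ := G_tors a i x
        have := ht 1 (by rw [hat, Ideal.top_pow]; trivial)
        rwa [one_smul] at this
      infer_instance
    have hne : {m : ℕ | ∃ c : Ideal R, (IsLocalRing.maximalIdeal R).radical = (c + a).radical ∧
        cohDim c M = m}.Nonempty := by
      refine ⟨_, IsLocalRing.maximalIdeal R, ?_, rfl⟩
      congr 1
      exact (sup_eq_left.2 (IsLocalRing.le_maximalIdeal hat)).symm
    obtain ⟨c, hc, hcd⟩ := Nat.sInf_mem hne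
    refine part2 a c ?_ M n (cohDimRel a (IsLocalRing.maximalIdeal R) M) ?_
      (fun i hi => htr i (h i hi)) i hi
    · rw [← hc]
      exact (IsLocalRing.maximalIdeal.isMaximal R).isPrime.radical
    · intro j hj
      by_contra hns
      have hnt : Nontrivial ((localCohomology c j).obj M) := by
        rw [not_subsingleton_iff_nontrivial] at hns
        exact (gequiv c j M).symm.toEquiv.nontrivial
      have hle : j ≤ cohDim c M := by
        refine le_csSup ?_ hnt
        obtain ⟨r, hr⟩ := cd_bound c
        refine ⟨r, fun k hk => ?_⟩
        by_contra! hrk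
        have := hr k hrk M
        have h2 : Nontrivial ((localCohomology c k).obj M) := hk
        exact not_subsingleton _ (gequiv c k M).symm.toEquiv.subsingleton
      rw [hcd] at hle
      exact absurd hj (not_lt.2 hle)
end

section
/- Let R be a commutative noetherian ring, let a and b be ideals of R, let X be an R-module, and let t be a non-negative integer such that H^{t-r}_a(H^r_b(X)) is artinian for all r with 0 ≤ r ≤ t. Then H^t_{a+b}(X) is artinian. -/
namespace LCAux
open CategoryTheory Limits

section Transport
universe v u
variable {C : Type u} [Category.{v} C]

lemma exact_transport [Preadditive C] {A B E A' B' E' : C} (a : A ≅ A') (b : B ≅ B') (e : E ≅ E')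
    (f' : A' ⟶ B') (g' : B' ⟶ E') (h : f' ≫ g' = 0) (hex : (ShortComplex.mk f' g' h).Exact)
    (f : A ⟶ B) (g : B ⟶ E) (hf : f = a.hom ≫ f' ≫ b.inv) (hg : g = b.hom ≫ g' ≫ e.inv) :
    ∃ h, (ShortComplex.mk f g h).Exact := by
  subst hf hg
  refine ⟨by simp [reassoc_of% h], ?_⟩
  refine ShortComplex.exact_of_iso (ShortComplex.isoMk a.symm b.symm e.symm ?_ ?_) hex <;> simp

lemma nat_transport {A A' B B' M M' N N' : C} (a : A ≅ A') (b : B ≅ B') (m : M ≅ M') (n : N ≅ N')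
    (f : A ⟶ B) (f' : A' ⟶ B') (hf : f ≫ b.hom = a.hom ≫ f')
    (g : M ⟶ N) (g' : M' ⟶ N') (hg : m.inv ≫ g = g' ≫ n.inv)
    (d : A' ⟶ M') (e : B' ⟶ N') (h : d ≫ g' = f' ≫ e) :
    f ≫ (b.hom ≫ e ≫ n.inv) = (a.hom ≫ d ≫ m.inv) ≫ g := by
  rw [reassoc_of% hf]
  simp only [Category.assoc, hg, reassoc_of% h]

lemma nat_transport2 {A B A' B' K L M N : C} (a : A ≅ A') (b : B ≅ B')
    (f' : A' ⟶ B') (f : A ⟶ B) (hf : f = a.hom ≫ f' ≫ b.inv)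
    (i : A' ⟶ K) (j : B' ⟶ L) (g : K ⟶ L) (h : f' ≫ j = i ≫ g)
    (p : K ⟶ M) (q : L ⟶ N) (r : M ⟶ N) (h' : g ≫ q = p ≫ r)
    (u : A ⟶ M) (v : B ⟶ N) (hu : u = a.hom ≫ i ≫ p) (hv : v = b.hom ≫ j ≫ q) :
    f ≫ v = u ≫ r := by
  subst hf hu hv
  simp [reassoc_of% h, h']

end Transport

section LES
universe v u v' u'
variable {C : Type u} [Category.{v} C] {D : Type u'} [Category.{v'} D]
  [Abelian C] [HasProjectiveResolutions C] [Abelian D]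

/-- complex short complex -/
noncomputable def cplx {F G H : C ⥤ D} [F.Additive] [G.Additive] [H.Additive]
    (α : F ⟶ G) (β : G ⟶ H) (w : α ≫ β = 0) (K : ChainComplex C ℕ) :
    ShortComplex (ChainComplex D ℕ) :=
  ShortComplex.mk ((NatTrans.mapHomologicalComplex α _).app K)
    ((NatTrans.mapHomologicalComplex β _).app K) (by
      ext i
      have := congrArg (fun t => t.app (K.X i)) w
      exact this)

noncomputable def cplxMap {F G H : C ⥤ D} [F.Additive] [G.Additive] [H.Additive]
    (α : F ⟶ G) (β : G ⟶ H) (w : α ≫ β = 0) {K L : ChainComplex C ℕ} (φ : K ⟶ L) :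
    cplx α β w K ⟶ cplx α β w L where
  τ₁ := (F.mapHomologicalComplex _).map φ
  τ₂ := (G.mapHomologicalComplex _).map φ
  τ₃ := (H.mapHomologicalComplex _).map φ
  comm₁₂ := by
    ext i
    simp [cplx]
  comm₂₃ := by
    ext i
    simp [cplx]

lemma cplx_shortExact {F G H : C ⥤ D} [F.Additive] [G.Additive] [H.Additive]
    (α : F ⟶ G) (β : G ⟶ H) (w : α ≫ β = 0)
    (hS : ∀ (P : C) [Projective P], (ShortComplex.mk (α.app P) (β.app P)
      (by rw [← NatTrans.comp_app, w]; rfl)).ShortExact)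
    {M : C} (P : ProjectiveResolution M) : (cplx α β w P.complex).ShortExact := by
  apply HomologicalComplex.shortExact_of_degreewise_shortExact
  intro i
  exact hS (P.complex.X i)

theorem leftDerived_les {F G H : C ⥤ D} [F.Additive] [G.Additive] [H.Additive]
    (α : F ⟶ G) (β : G ⟶ H) (w : α ≫ β = 0)
    (hS : ∀ (P : C) [Projective P], (ShortComplex.mk (α.app P) (β.app P)
      (by rw [← NatTrans.comp_app, w]; rfl)).ShortExact) (n : ℕ) :
    ∃ (δ : H.leftDerived (n+1) ⟶ F.leftDerived n),
      (∀ M, ∃ h, (ShortComplex.mk ((NatTrans.leftDerived β (n+1)).app M) (δ.app M) h).Exact) ∧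
      (∀ M, ∃ h, (ShortComplex.mk (δ.app M) ((NatTrans.leftDerived α n).app M) h).Exact) ∧
      (∀ M, ∃ h, (ShortComplex.mk ((NatTrans.leftDerived α n).app M)
        ((NatTrans.leftDerived β n).app M) h).Exact) := by
  let hE := fun M : C => cplx_shortExact α β w hS (projectiveResolution M)
  let d : ∀ M : C, (H.leftDerived (n+1)).obj M ⟶ (F.leftDerived n).obj M := fun M =>
    ((projectiveResolution M).isoLeftDerivedObj H (n+1)).hom ≫ (hE M).δ (n+1) n (by simp) ≫
      ((projectiveResolution M).isoLeftDerivedObj F n).inv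
  refine ⟨{ app := d, naturality := ?_ }, ?_, ?_, ?_⟩
  · intro M N f
    let φ := ProjectiveResolution.lift f (projectiveResolution M) (projectiveResolution N)
    have hc : φ.f 0 ≫ (projectiveResolution N).π.f 0 = (projectiveResolution M).π.f 0 ≫ f := by
      exact ProjectiveResolution.lift_commutes_zero _ _ _
    exact nat_transport _ _ _ _ _ _
      (ProjectiveResolution.isoLeftDerivedObj_hom_naturality f
        (projectiveResolution M) (projectiveResolution N) φ hc H (n+1)) _ _
      (ProjectiveResolution.isoLeftDerivedObj_inv_naturality f
        (projectiveResolution M) (projectiveResolution N) φ hc F n) _ _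
      (HomologicalComplex.HomologySequence.δ_naturality (cplxMap α β w φ)
        (hE M) (hE N) (n+1) n (by simp))
  · intro M
    exact exact_transport _ _ _ _ _ _ ((hE M).homology_exact₃ (n+1) n (by simp)) _ _
      ((projectiveResolution M).leftDerived_app_eq β _) rfl
  · intro M
    exact exact_transport _ _ _ _ _ _ ((hE M).homology_exact₁ (n+1) n (by simp)) _ _
      rfl ((projectiveResolution M).leftDerived_app_eq α _)
  · intro M
    exact exact_transport _ _ _ _ _ _ ((hE M).homology_exact₂ n) _ _
      ((projectiveResolution M).leftDerived_app_eq α _) ((projectiveResolution M).leftDerived_app_eq β _)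

lemma fromLeftDerivedZero'_nat {F G : C ⥤ D} [F.Additive] [G.Additive]
    (α : F ⟶ G) {M : C} (P : ProjectiveResolution M) :
    HomologicalComplex.opcyclesMap ((NatTrans.mapHomologicalComplex α _).app P.complex) 0 ≫
      P.fromLeftDerivedZero' G = P.fromLeftDerivedZero' F ≫ α.app M := by
  rw [← cancel_epi (HomologicalComplex.pOpcycles _ _), HomologicalComplex.p_opcyclesMap_assoc]
  have h1 := ProjectiveResolution.pOpcycles_comp_fromLeftDerivedZero' P G
  have h2 := ProjectiveResolution.pOpcycles_comp_fromLeftDerivedZero' P F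
  rw [h1, reassoc_of% h2]
  exact (α.naturality _).symm

theorem fromLeftDerivedZero_nat {F G : C ⥤ D} [F.Additive] [G.Additive] 
    (α : F ⟶ G) (M : C) :
    (NatTrans.leftDerived α 0).app M ≫ G.fromLeftDerivedZero.app M =
      F.fromLeftDerivedZero.app M ≫ α.app M :=
  nat_transport2 _ _ _ _ ((projectiveResolution M).leftDerived_app_eq α 0) 
    (ChainComplex.isoHomologyι₀ _).hom (ChainComplex.isoHomologyι₀ _).hom _
    (HomologicalComplex.homologyι_naturality _ _) _ _ _
    (fromLeftDerivedZero'_nat α (projectiveResolution M)) _ _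
    ((projectiveResolution M).fromLeftDerivedZero_eq F) 
    ((projectiveResolution M).fromLeftDerivedZero_eq G)

theorem isZero_leftDerived_of_preserves (F : C ⥤ D) [F.Additive]
    (hF : ∀ S : ShortComplex C, S.Exact → (S.map F).Exact) (M : C)
    (n : ℕ) : IsZero ((F.leftDerived (n+1)).obj M) := by
  refine IsZero.of_iso ?_ ((projectiveResolution M).isoLeftDerivedObj F (n + 1))
  have : (projectiveResolution M).complex.ExactAt (n+1) := by
    exact ProjectiveResolution.complex_exactAt_succ _ _
  erw [← HomologicalComplex.exactAt_iff_isZero_homology]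
  rw [HomologicalComplex.exactAt_iff] at this ⊢
  exact hF _ this

end LES

section LC
open Opposite localCohomology
variable {R : Type} [CommRing R]

/-- Hom(-,Y) as functor to the opposite -/
noncomputable abbrev FY (Y : ModuleCat.{0} R) : ModuleCat.{0} R ⥤ (ModuleCat.{0} R)ᵒᵖ :=
  ((linearYoneda R (ModuleCat.{0} R)).obj Y).rightOp

noncomputable abbrev FYmap {X Y : ModuleCat.{0} R} (f : X ⟶ Y) : FY Y ⟶ FY X :=
  NatTrans.rightOp ((linearYoneda R (ModuleCat.{0} R)).map f)

lemma FYmap_zero {X Y Z : ModuleCat.{0} R} (f : X ⟶ Y) (g : Y ⟶ Z) (w : f ≫ g = 0) :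
    FYmap g ≫ FYmap f = 0 := by
  ext M
  apply Quiver.Hom.unop_inj
  ext x
  have key : ∀ y : M ⟶ X, (y ≫ f) ≫ g = 0 := fun y => by rw [Category.assoc, w, comp_zero]
  exact key x

lemma FY_shortExact (S : ShortComplex (ModuleCat.{0} R)) (hS : S.ShortExact)
    (P : ModuleCat.{0} R) [Projective P] :
    (ShortComplex.mk ((FYmap S.g).app P) ((FYmap S.f).app P)
      (by rw [← NatTrans.comp_app, FYmap_zero _ _ S.zero]; rfl)).ShortExact := by
  have := hS.mono_f
  have := hS.epi_g
  have h : (ShortComplex.mk (((linearYoneda R (ModuleCat.{0} R)).map S.f).app (op P))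
    (((linearYoneda R (ModuleCat.{0} R)).map S.g).app (op P)) (by 
      ext x
      have key : ∀ y : P ⟶ S.X₁, (y ≫ S.f) ≫ S.g = 0 := fun y => by simp
      exact key x)).ShortExact := by
    refine ShortComplex.ShortExact.mk' ?_ ?_ ?_
    · rw [ShortComplex.moduleCat_exact_iff]
      intro (x : P ⟶ S.X₂) (hx : x ≫ S.g = 0)
      exact ⟨hS.exact.lift x hx, hS.exact.lift_f x hx⟩
    · rw [ModuleCat.mono_iff_injective]
      intro (x : P ⟶ S.X₁) (y : P ⟶ S.X₁) (hxy : x ≫ S.f = y ≫ S.f)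
      exact (cancel_mono S.f).1 hxy
    · rw [ModuleCat.epi_iff_surjective]
      intro (x : P ⟶ S.X₃)
      exact ⟨Projective.factorThru x S.g, Projective.factorThru_comp x S.g⟩
  exact h.op

instance fy_pres (Y : ModuleCat.{0} R) : PreservesFiniteColimits (FY Y) := by
  have : PreservesFiniteLimits ((linearYoneda R (ModuleCat.{0} R)).obj Y) := by
    constructor
    intro J _ _
    have : PreservesLimitsOfShape J
        ((linearYoneda R (ModuleCat.{0} R)).obj Y ⋙ forget (ModuleCat.{0} R)) :=
      inferInstanceAs (PreservesLimitsOfShape J (yoneda.obj Y))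
    exact preservesLimitsOfShape_of_reflects_of_preserves _ (forget (ModuleCat.{0} R))
  exact Limits.preservesFiniteColimits_rightOp _

lemma isZero_ext_of_injective (E M : ModuleCat.{0} R) [Injective E] (n : ℕ) :
    IsZero (((Ext R (ModuleCat.{0} R) (n+1)).obj (op M)).obj E) := by
  have : IsZero (((FY E).leftDerived (n+1)).obj M) := by
    apply isZero_leftDerived_of_preserves
    intro S hS
    rw [← ShortComplex.exact_unop_iff, ShortComplex.moduleCat_exact_iff]
    intro (x : S.X₂ ⟶ E) (hx : S.f ≫ x = 0)
    exact ⟨hS.descToInjective x hx, hS.comp_descToInjective x hx⟩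
  exact this.unop

theorem ext_les (S : ShortComplex (ModuleCat.{0} R)) (hS : S.ShortExact) (n : ℕ) :
    ∃ (δ : (Ext R (ModuleCat.{0} R) n).flip.obj S.X₃ ⟶ (Ext R (ModuleCat.{0} R) (n+1)).flip.obj S.X₁),
      (∀ M, ∃ h, (ShortComplex.mk (((Ext R (ModuleCat.{0} R) n).obj M).map S.g) (δ.app M) h).Exact) ∧
      (∀ M, ∃ h, (ShortComplex.mk (δ.app M) (((Ext R (ModuleCat.{0} R) (n+1)).obj M).map S.f) h).Exact) ∧
      (∀ M, ∃ h, (ShortComplex.mk (((Ext R (ModuleCat.{0} R) n).obj M).map S.f)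
        (((Ext R (ModuleCat.{0} R) n).obj M).map S.g) h).Exact) := by
  obtain ⟨δ, h1, h2, h3⟩ := leftDerived_les (FYmap S.g) (FYmap S.f) (FYmap_zero _ _ S.zero)
    (FY_shortExact S hS) n
  refine ⟨NatTrans.leftOp δ, fun M => ?_, fun M => ?_, fun M => ?_⟩
  · obtain ⟨h, hh⟩ := h2 M.unop
    exact ⟨Quiver.Hom.op_inj h, hh.unop⟩
  · obtain ⟨h, hh⟩ := h1 M.unop
    exact ⟨Quiver.Hom.op_inj h, hh.unop⟩
  · obtain ⟨h, hh⟩ := h3 M.unop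
    exact ⟨Quiver.Hom.op_inj h, hh.unop⟩


lemma functor_exact {J : Type} [SmallCategory J] (S : ShortComplex (J ⥤ ModuleCat.{0} R))
    (h : ∀ j, (S.map ((evaluation J (ModuleCat.{0} R)).obj j)).Exact) : S.Exact := by
  rw [ShortComplex.exact_iff_isZero_homology]
  apply Functor.isZero
  intro j
  have h1 := (ShortComplex.exact_iff_isZero_homology _).1 (h j)
  exact h1.of_iso (S.mapHomologyIso ((evaluation J (ModuleCat.{0} R)).obj j)).symm

/-- the diagram at a module -/
noncomputable abbrev Dg (a : Ideal R) (n : ℕ) (Y : ModuleCat.{0} R) :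
    (ℕᵒᵖ)ᵒᵖ ⥤ ModuleCat.{0} R :=
  (ringModIdeals (idealPowersDiagram a)).op ⋙ (Ext R (ModuleCat.{0} R) n).flip.obj Y

noncomputable def ιL (a : Ideal R) (n : ℕ) (j : (ℕᵒᵖ)ᵒᵖ) :
    (diagram (idealPowersDiagram a) n).obj j ⟶ localCohomology a n :=
  haveI := hasColimitDiagram.{0, 0} (idealPowersDiagram a) n
  colimit.ι (diagram (idealPowersDiagram a) n) j

noncomputable def cocL (a : Ideal R) (n : ℕ) (Y : ModuleCat.{0} R) : Cocone (Dg a n Y) where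
  pt := (localCohomology a n).obj Y
  ι := 
    { app := fun j => (ιL a n j).app Y
      naturality := fun i j f => by
        have := hasColimitDiagram.{0, 0} (idealPowersDiagram a) n
        have h := congrArg (fun t => t.app Y) (colimit.w (diagram (idealPowersDiagram a) n) f)
        refine Eq.trans h ?_
        exact (Category.comp_id _).symm }

noncomputable def cocL_isColimit (a : Ideal R) (n : ℕ) (Y : ModuleCat.{0} R) :
    IsColimit (cocL a n Y) :=
  haveI := hasColimitDiagram.{0, 0} (idealPowersDiagram a) n
  isColimitOfPreserves ((evaluation _ _).obj Y)
    (colimit.isColimit (diagram (idealPowersDiagram a) n))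

instance hasExact : HasExactColimitsOfShape (ℕᵒᵖ)ᵒᵖ (ModuleCat.{0} R) := inferInstance

theorem lc_les (a : Ideal R) (S : ShortComplex (ModuleCat.{0} R)) (hS : S.ShortExact) (n : ℕ) :
    ∃ (δ : (localCohomology a n).obj S.X₃ ⟶ (localCohomology a (n+1)).obj S.X₁),
      (∃ h, (ShortComplex.mk ((localCohomology a n).map S.g) δ h).Exact) ∧
      (∃ h, (ShortComplex.mk δ ((localCohomology a (n+1)).map S.f) h).Exact) ∧
      (∃ h, (ShortComplex.mk ((localCohomology a n).map S.f)
        ((localCohomology a n).map S.g) h).Exact) := by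
  obtain ⟨δ, h1, h2, h3⟩ := ext_les S hS n
  let K := (ringModIdeals (idealPowersDiagram a)).op
  let δ' : Dg a n S.X₃ ⟶ Dg a (n+1) S.X₁ := Functor.whiskerLeft K δ
  let fm : ∀ m, Dg a m S.X₁ ⟶ Dg a m S.X₂ := fun m =>
    Functor.whiskerLeft K ((Ext R (ModuleCat.{0} R) m).flip.map S.f)
  let gm : ∀ m, Dg a m S.X₂ ⟶ Dg a m S.X₃ := fun m =>
    Functor.whiskerLeft K ((Ext R (ModuleCat.{0} R) m).flip.map S.g)
  have nf : ∀ {X Y : ModuleCat.{0} R} (f : X ⟶ Y) m j, (cocL a m X).ι.app j ≫ (localCohomology a m).map f =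
      ((Ext R (ModuleCat.{0} R) m).flip.map f).app (K.obj j) ≫ (cocL a m Y).ι.app j := by
    intro X Y f m j
    exact ((ιL a m j).naturality f).symm
  have nδ := fun j => (cocL_isColimit a n S.X₃).ι_map (cocL a (n+1) S.X₁) δ' j
  refine ⟨(cocL_isColimit a n S.X₃).map (cocL a (n+1) S.X₁) δ', ?_, ?_, ?_⟩
  · refine ⟨_, colim.exact_mapShortComplex (S := ShortComplex.mk (gm n) δ' ?_) ?_
      (cocL_isColimit a n S.X₂) (cocL_isColimit a n S.X₃) (cocL_isColimit a (n+1) S.X₁) _ _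
      (fun j => nf S.g n j) nδ⟩
    · ext1; ext1 j
      exact (h1 (K.obj j)).1
    · apply functor_exact
      intro j
      exact (h1 (K.obj j)).2
  · refine ⟨_, colim.exact_mapShortComplex (S := ShortComplex.mk δ' (fm (n+1)) ?_) ?_
      (cocL_isColimit a n S.X₃) (cocL_isColimit a (n+1) S.X₁) (cocL_isColimit a (n+1) S.X₂) _ _
      nδ (fun j => nf S.f (n+1) j)⟩
    · ext1; ext1 j
      exact (h2 (K.obj j)).1
    · apply functor_exact
      intro j
      exact (h2 (K.obj j)).2
  · refine ⟨_, colim.exact_mapShortComplex (S := ShortComplex.mk (fm n) (gm n) ?_) ?_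
      (cocL_isColimit a n S.X₁) (cocL_isColimit a n S.X₂) (cocL_isColimit a n S.X₃) _ _
      (fun j => nf S.f n j) (fun j => nf S.g n j)⟩
    · ext1; ext1 j
      exact (h3 (K.obj j)).1
    · apply functor_exact
      intro j
      exact (h3 (K.obj j)).2

lemma lc_injective (a : Ideal R) (E : ModuleCat.{0} R) [Injective E] (n : ℕ) :
    IsZero ((localCohomology a (n+1)).obj E) := by
  rw [IsZero.iff_id_eq_zero]
  apply (cocL_isColimit a (n+1) E).hom_ext
  intro j
  apply IsZero.eq_of_src
  exact isZero_ext_of_injective E _ n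

/-- Ext^0(M,Y) → Hom(M,Y), natural -/
noncomputable def extZeroIso (M Y : ModuleCat.{0} R) :
    ((Ext R (ModuleCat.{0} R) 0).obj (op M)).obj Y ≅
      ((linearYoneda R (ModuleCat.{0} R)).obj Y).obj (op M) :=
  ((FY Y).leftDerivedZeroIsoSelf.app M).unop.symm

lemma extZeroIso_nat_left {M N : ModuleCat.{0} R} (f : M ⟶ N) (Y : ModuleCat.{0} R) :
    ((Ext R (ModuleCat.{0} R) 0).map f.op).app Y ≫ (extZeroIso M Y).hom =
      (extZeroIso N Y).hom ≫ ((linearYoneda R (ModuleCat.{0} R)).obj Y).map f.op := by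
  have h := (FY Y).leftDerivedZeroIsoSelf.inv.naturality f
  exact Quiver.Hom.op_inj h.symm

lemma extZeroIso_nat_right (M : ModuleCat.{0} R) {X Y : ModuleCat.{0} R} (f : X ⟶ Y) :
    ((Ext R (ModuleCat.{0} R) 0).obj (op M)).map f ≫ (extZeroIso M Y).hom =
      (extZeroIso M X).hom ≫ ((linearYoneda R (ModuleCat.{0} R)).map f).app (op M) := by
  have h := fromLeftDerivedZero_nat (FYmap f) M
  have h2 : (FYmap f).app M ≫ (FY X).leftDerivedZeroIsoSelf.inv.app M = 
      (FY Y).leftDerivedZeroIsoSelf.inv.app M ≫ (NatTrans.leftDerived (FYmap f) 0).app M := by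
    have e1 := (FY X).leftDerivedZeroIsoSelf_hom_inv_id_app M
    have e2 := (FY Y).leftDerivedZeroIsoSelf_inv_hom_id_app M
    rw [← Category.comp_id ((NatTrans.leftDerived (FYmap f) 0).app M), ← e1, reassoc_of% h,
      reassoc_of% e2]
  exact Quiver.Hom.op_inj h2.symm

end LC

section Gam
open Opposite localCohomology
variable {R : Type} [CommRing R]

/-- evaluation at one -/
noncomputable def evOne (J : Ideal R) (X : ModuleCat.{0} R) :
    ((linearYoneda R (ModuleCat.{0} R)).obj X).obj (op (ModuleCat.of R (R ⧸ J))) ⟶ X :=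
  ModuleCat.ofHom
    { toFun := fun (φ : ModuleCat.of R (R ⧸ J) ⟶ X) => φ.hom (Submodule.Quotient.mk (1 : R))
      map_add' := fun _ _ => rfl
      map_smul' := fun _ _ => rfl }

lemma evOne_apply (J : Ideal R) (X : ModuleCat.{0} R) (φ : ModuleCat.of R (R ⧸ J) ⟶ X) :
    (evOne J X).hom φ = φ.hom (Submodule.Quotient.mk (1 : R)) := rfl

lemma evOne_inj (J : Ideal R) (X : ModuleCat.{0} R) : Function.Injective (evOne J X).hom := by
  intro (φ : ModuleCat.of R (R ⧸ J) ⟶ X) (ψ : ModuleCat.of R (R ⧸ J) ⟶ X)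
    (h : φ.hom (Submodule.Quotient.mk (1 : R)) = ψ.hom (Submodule.Quotient.mk (1 : R)))
  have key : φ = ψ := by
    apply ModuleCat.hom_ext
    apply LinearMap.ext
    intro x
    obtain ⟨r, rfl⟩ := Submodule.Quotient.mk_surjective _ x
    have : (Submodule.Quotient.mk r : R ⧸ J) = r • Submodule.Quotient.mk (1:R) := by
      rw [← Submodule.Quotient.mk_smul, smul_eq_mul, mul_one]
    rw [this]
    exact (φ.hom.map_smul r _).trans ((congrArg (r • ·) h).trans (ψ.hom.map_smul r _).symm)
  exact key

lemma evOne_range (J : Ideal R) (X : ModuleCat.{0} R) (x : X) :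
    (∃ φ, (evOne J X).hom φ = x) ↔ ∀ r ∈ J, r • x = 0 := by
  constructor
  · rintro ⟨φ, rfl⟩ r hr
    have key : ∀ φ : ModuleCat.of R (R ⧸ J) ⟶ X, r • φ.hom (Submodule.Quotient.mk (1 : R)) = 0 := by
      intro φ
      rw [← map_smul, ← Submodule.Quotient.mk_smul, smul_eq_mul, mul_one,
        (Submodule.Quotient.mk_eq_zero J).2 hr, map_zero]
    exact key φ
  · intro h
    let φ : ModuleCat.of R (R ⧸ J) ⟶ X := ModuleCat.ofHom
      (Submodule.liftQ J (LinearMap.toSpanSingleton R X x) (fun r hr => h r hr))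
    refine ⟨φ, ?_⟩
    have : φ.hom (Submodule.Quotient.mk (1 : R)) = x := one_smul R x
    exact this

lemma evOne_nat (J : Ideal R) {X Y : ModuleCat.{0} R} (f : X ⟶ Y) :
    ((linearYoneda R (ModuleCat.{0} R)).map f).app (op (ModuleCat.of R (R ⧸ J))) ≫ evOne J Y =
      evOne J X ≫ f := by
  ext x
  rfl

/-- stage map -/
noncomputable def stg (J : Ideal R) (X : ModuleCat.{0} R) :
    ((Ext R (ModuleCat.{0} R) 0).obj (op (ModuleCat.of R (R ⧸ J)))).obj X ⟶ X :=
  (extZeroIso (ModuleCat.of R (R ⧸ J)) X).hom ≫ evOne J X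

lemma stg_nat (J : Ideal R) {X Y : ModuleCat.{0} R} (f : X ⟶ Y) :
    ((Ext R (ModuleCat.{0} R) 0).obj (op (ModuleCat.of R (R ⧸ J)))).map f ≫ stg J Y =
      stg J X ≫ f := by
  have h := extZeroIso_nat_right (ModuleCat.of R (R ⧸ J)) f
  unfold stg
  rw [reassoc_of% h, evOne_nat, Category.assoc]

lemma stg_nat_left {I J : Ideal R} (h : I ≤ J) (X : ModuleCat.{0} R) :
    ((Ext R (ModuleCat.{0} R) 0).map (Quiver.Hom.op (ModuleCat.ofHom
      (Submodule.mapQ I J LinearMap.id h) :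
        ModuleCat.of R (R ⧸ I) ⟶ ModuleCat.of R (R ⧸ J)))).app X ≫ stg I X = stg J X := by
  have h := extZeroIso_nat_left (ModuleCat.ofHom (Submodule.mapQ I J LinearMap.id h) :
        ModuleCat.of R (R ⧸ I) ⟶ ModuleCat.of R (R ⧸ J)) X
  unfold stg
  rw [reassoc_of% h]
  rfl

lemma stg_inj (J : Ideal R) (X : ModuleCat.{0} R) : Function.Injective (stg J X).hom := by
  have : Function.Injective ((extZeroIso (ModuleCat.of R (R ⧸ J)) X).hom).hom :=
    (ModuleCat.mono_iff_injective _).1 inferInstance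
  exact (evOne_inj J X).comp this

lemma stg_range (J : Ideal R) (X : ModuleCat.{0} R) (x : X) :
    (∃ φ, (stg J X).hom φ = x) ↔ ∀ r ∈ J, r • x = 0 := by
  rw [← evOne_range]
  have : Function.Surjective ((extZeroIso (ModuleCat.of R (R ⧸ J)) X).hom).hom :=
    (ModuleCat.epi_iff_surjective _).1 inferInstance
  constructor
  · rintro ⟨φ, rfl⟩
    exact ⟨_, rfl⟩
  · rintro ⟨φ, rfl⟩
    obtain ⟨ψ, rfl⟩ := this φ
    exact ⟨ψ, rfl⟩

noncomputable def epsCocone (a : Ideal R) (X : ModuleCat.{0} R) : Cocone (Dg a 0 X) where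
  pt := X
  ι := 
    { app := fun j => stg (a ^ unop (unop j)) X
      naturality := fun i j f => by
        have h := stg_nat_left (Ideal.pow_le_pow_right (I := a) f.unop.unop.down.down) X
        exact h.trans (Category.comp_id _).symm }

noncomputable def eps (a : Ideal R) (X : ModuleCat.{0} R) : (localCohomology a 0).obj X ⟶ X :=
  (cocL_isColimit a 0 X).desc (epsCocone a X)

lemma eps_fac (a : Ideal R) (X : ModuleCat.{0} R) (j) :
    (cocL a 0 X).ι.app j ≫ eps a X = stg (a ^ unop (unop j)) X :=
  (cocL_isColimit a 0 X).fac (epsCocone a X) j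

lemma nat_glue {C : Type*} [Category C] {A A' B B' D E : C} (i : A ⟶ B) (m : B ⟶ B') (e : B' ⟶ D)
    (e' : B ⟶ E) (f : E ⟶ D) (i' : A' ⟶ B') (n : A ⟶ A') (s : A ⟶ E) (s' : A' ⟶ D)
    (h1 : i ≫ m = n ≫ i') (h2 : i' ≫ e = s') (h3 : i ≫ e' = s) (h4 : n ≫ s' = s ≫ f) :
    i ≫ m ≫ e = i ≫ e' ≫ f := by
  rw [reassoc_of% h1, h2, h4, reassoc_of% h3]

lemma eps_nat (a : Ideal R) {X Y : ModuleCat.{0} R} (f : X ⟶ Y) :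
    (localCohomology a 0).map f ≫ eps a Y = eps a X ≫ f := by
  apply (cocL_isColimit a 0 X).hom_ext
  intro j
  have h1 : (cocL a 0 X).ι.app j ≫ (localCohomology a 0).map f = _ := ((ιL a 0 j).naturality f).symm
  have h2 := stg_nat (a ^ unop (unop j)) f
  have h3 := eps_fac a Y j
  have h4 := eps_fac a X j
  exact nat_glue _ _ _ _ _ _ _ _ _ h1 h3 h4 h2

lemma eps_rep (a : Ideal R) (X : ModuleCat.{0} R) (y : (localCohomology a 0).obj X) :
    ∃ j z, ((cocL a 0 X).ι.app j).hom z = y := 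
  Concrete.isColimit_exists_rep (Dg a 0 X) (cocL_isColimit a 0 X) y

lemma eps_inj (a : Ideal R) (X : ModuleCat.{0} R) : Function.Injective (eps a X).hom := by
  rw [← LinearMap.ker_eq_bot, LinearMap.ker_eq_bot']
  intro y hy
  obtain ⟨j, z, rfl⟩ := eps_rep a X y
  have h : (stg (a ^ unop (unop j)) X).hom z = 0 := by
    rw [← eps_fac]
    exact hy
  have : z = 0 := stg_inj _ _ (h.trans (map_zero _).symm)
  rw [this]
  exact map_zero _

lemma eps_range (a : Ideal R) (X : ModuleCat.{0} R) (x : X) :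
    (∃ y, (eps a X).hom y = x) ↔ ∃ n : ℕ, ∀ r ∈ a ^ n, r • x = 0 := by
  constructor
  · rintro ⟨y, rfl⟩
    obtain ⟨j, z, rfl⟩ := eps_rep a X y
    refine ⟨unop (unop j), (stg_range _ _ _).1 ⟨z, ?_⟩⟩
    rw [← eps_fac]
    rfl
  · rintro ⟨n, hn⟩
    obtain ⟨z, hz⟩ := (stg_range _ _ _).2 hn
    refine ⟨((cocL a 0 X).ι.app (op (op n))).hom z, ?_⟩
    rw [← hz]
    exact congrArg (fun f => f.hom z) (eps_fac a X (op (op n)))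

end Gam

section Inj
variable {R : Type} [CommRing R]

lemma uniform_kill (b : Ideal R) {M E : Type} [AddCommGroup M] [Module R M] [Module.Finite R M]
    [AddCommGroup E] [Module R E] (f : M →ₗ[R] E)
    (h : ∀ x, ∃ n : ℕ, ∀ r ∈ b ^ n, r • f x = 0) : ∃ n : ℕ, ∀ x, ∀ r ∈ b ^ n, r • f x = 0 := by
  obtain ⟨s, hs⟩ := (Module.Finite.fg_top : (⊤ : Submodule R M).FG)
  choose n hn using h
  refine ⟨s.sup n, fun x r hr => ?_⟩
  have hx : x ∈ Submodule.span R (s : Set M) := hs ▸ Submodule.mem_top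
  induction hx using Submodule.span_induction with
  | mem x hx => exact hn x r (Ideal.pow_le_pow_right (Finset.le_sup hx) hr)
  | zero => simp
  | add x y _ _ hx hy => rw [map_add, smul_add, hx, hy, add_zero]
  | smul c x _ hx => rw [map_smul, smul_comm, hx, smul_zero]

lemma gamma_baer [IsNoetherianRing R] (b : Ideal R) {Q E : Type} [AddCommGroup Q] [Module R Q]
    [AddCommGroup E] [Module R E] [Module.Injective R E] (e : Q →ₗ[R] E)
    (he : Function.Injective e)
    (hr : ∀ x, (∃ y, e y = x) ↔ ∃ n : ℕ, ∀ r ∈ b ^ n, r • x = 0) : Module.Baer R Q := by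
  intro I g
  obtain ⟨n, hn⟩ := uniform_kill b (e ∘ₗ g) (fun x => (hr _).1 ⟨g x, rfl⟩)
  obtain ⟨k, hk⟩ := Ideal.exists_pow_inf_eq_pow_smul b (M := R) I
  have hk := hk (n + k) (Nat.le_add_left _ _)
  rw [Nat.add_sub_cancel] at hk
  have hle : b ^ n • (I : Submodule R R) ≤ (LinearMap.ker (e ∘ₗ g)).map I.subtype := by
    rw [Submodule.smul_le]
    intro r hr i hi
    exact ⟨r • ⟨i, hi⟩, by
      rw [SetLike.mem_coe, LinearMap.mem_ker, map_smul]; exact hn _ r hr, rfl⟩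
  let p : I →ₗ[R] (R ⧸ b ^ (n + k)) := (Submodule.mkQ (b ^ (n+k))) ∘ₗ I.subtype
  have hker : LinearMap.ker p ≤ LinearMap.ker (e ∘ₗ g) := by
    intro x hx
    have hx1 : (x : R) ∈ b ^ (n+k) := (Submodule.Quotient.mk_eq_zero _).1 hx
    have hx2 : (x : R) ∈ b ^ (n + k) • (⊤ : Submodule R R) ⊓ I := by
      refine ⟨?_, x.2⟩
      have := Submodule.smul_mem_smul hx1 (Submodule.mem_top : (1 : R) ∈ (⊤ : Submodule R R))
      simpa using this
    rw [hk] at hx2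
    obtain ⟨y, hy, hyx⟩ := hle (Submodule.smul_mono le_rfl inf_le_right hx2)
    have : y = x := Subtype.ext hyx
    rw [← this]
    exact hy
  obtain ⟨h, hh⟩ := Module.Injective.out ((LinearMap.ker p).liftQ p le_rfl)
    (LinearMap.ker_eq_bot.1 (Submodule.ker_liftQ_eq_bot _ _ _ le_rfl))
    ((LinearMap.ker p).liftQ (e ∘ₗ g) hker)
  have hmk : ∀ r : R, h (Submodule.Quotient.mk r) = r • h (Submodule.Quotient.mk 1) := by
    intro r
    rw [← map_smul, ← Submodule.Quotient.mk_smul, smul_eq_mul, mul_one]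
  obtain ⟨q, hq⟩ := (hr (h (Submodule.Quotient.mk 1))).2 ⟨n + k, fun r hr => by
    rw [← hmk, (Submodule.Quotient.mk_eq_zero _).2 hr, map_zero]⟩
  refine ⟨LinearMap.toSpanSingleton R Q q, fun x hx => he ?_⟩
  rw [LinearMap.toSpanSingleton_apply, map_smul, hq, ← hmk]
  exact hh (Submodule.Quotient.mk ⟨x, hx⟩)

lemma gamma_injective [IsNoetherianRing R] (b : Ideal R) (E : ModuleCat.{0} R) [Injective E] :
    Injective ((localCohomology b 0).obj E) := by
  have : Module.Injective R E := Module.injective_module_of_injective_object R E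
  have h : Module.Injective R ((localCohomology b 0).obj E) :=
    (gamma_baer b (eps b E).hom (eps_inj b E) (eps_range b E)).injective
  exact Module.injective_object_of_injective_module R ((localCohomology b 0).obj E)

lemma lc_comp_surj (a b : Ideal R) (X : ModuleCat.{0} R) :
    ∃ φ : (localCohomology a 0).obj ((localCohomology b 0).obj X) ⟶ (localCohomology (a + b) 0).obj X,
      φ ≫ eps (a + b) X = eps a _ ≫ eps b X ∧ Function.Surjective φ.hom := by
  have hr : ∀ y : (localCohomology a 0).obj ((localCohomology b 0).obj X), ∃ z, 
      (eps (a+b) X).hom z = (eps b X).hom ((eps a _).hom y) := by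
    intro y
    obtain ⟨n, hn⟩ := (eps_range a ((localCohomology b 0).obj X) _).1 ⟨y, rfl⟩
    obtain ⟨m, hm⟩ := (eps_range b X _).1 ⟨(eps a _).hom y, rfl⟩
    refine (eps_range (a+b) X _).2 ⟨n + m, fun r hr => ?_⟩
    obtain ⟨u, hu, v, hv, rfl⟩ := Submodule.mem_sup.1 (Ideal.sup_pow_add_le_pow_sup_pow hr)
    rw [add_smul, hm v hv, ← map_smul, hn u hu, map_zero, add_zero]
  choose F hF using hr
  let L : (localCohomology a 0).obj ((localCohomology b 0).obj X) →ₗ[R]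
      (localCohomology (a+b) 0).obj X :=
    { toFun := F
      map_add' := fun y z => eps_inj (a+b) X (by
        rw [map_add, hF, hF, hF, map_add, map_add])
      map_smul' := fun r z => eps_inj (a+b) X (by
        rw [map_smul, hF, hF, map_smul, map_smul]; rfl) }
  refine ⟨ModuleCat.ofHom L, ?_, ?_⟩
  · ext y
    exact hF y
  · intro z
    obtain ⟨n, hn⟩ := (eps_range (a+b) X _).1 ⟨z, rfl⟩
    obtain ⟨y, hy⟩ := (eps_range b X ((eps (a+b) X).hom z)).2 ⟨n, fun r hr =>
      hn r (Ideal.pow_right_mono le_sup_right n hr)⟩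
    obtain ⟨x, hx⟩ := (eps_range a _ y).2 ⟨n, fun r hr => eps_inj b X (by
      rw [map_smul, hy, map_zero]; exact hn r (Ideal.pow_right_mono le_sup_left n hr))⟩
    refine ⟨x, eps_inj (a+b) X ?_⟩
    refine (hF x).trans ?_
    rw [hx, hy]

end Inj

section Main
variable {R : Type} [CommRing R]

lemma gamma_map_inj (a : Ideal R) {X Y : ModuleCat.{0} R} (f : X ⟶ Y)
    (hf : Function.Injective f.hom) : Function.Injective ((localCohomology a 0).map f).hom := by
  have h : Function.Injective ((localCohomology a 0).map f ≫ eps a Y).hom := by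
    rw [eps_nat]
    exact hf.comp (eps_inj a X)
  exact Function.Injective.of_comp h

lemma ex_iff {X Y Z : ModuleCat.{0} R} {f : X ⟶ Y} {g : Y ⟶ Z}
    (h : ∃ h, (ShortComplex.mk f g h).Exact) : LinearMap.range f.hom = LinearMap.ker g.hom := by
  obtain ⟨w, h⟩ := h
  exact (ShortComplex.moduleCat_exact_iff_range_eq_ker _).1 h

lemma zero_of_isZero {X : ModuleCat.{0} R} (h : IsZero X) (x : X) : x = 0 := by
  have := ModuleCat.subsingleton_of_isZero h
  exact Subsingleton.elim _ _

/-- long exact sequence, linear form -/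
lemma les (a : Ideal R) {X Y Z : ModuleCat.{0} R} (f : X ⟶ Y) (g : Y ⟶ Z)
    (hf : Function.Injective f.hom) (hg : Function.Surjective g.hom)
    (hfg : LinearMap.range f.hom = LinearMap.ker g.hom) (n : ℕ) :
    ∃ δ : (localCohomology a n).obj Z ⟶ (localCohomology a (n+1)).obj X,
      LinearMap.range ((localCohomology a n).map g).hom = LinearMap.ker δ.hom ∧ 
      LinearMap.range δ.hom = LinearMap.ker ((localCohomology a (n+1)).map f).hom ∧
      LinearMap.range ((localCohomology a n).map f).hom =
        LinearMap.ker ((localCohomology a n).map g).hom := by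
  have w : f ≫ g = 0 := by
    ext x
    have : f.hom x ∈ LinearMap.ker g.hom := hfg ▸ ⟨x, rfl⟩
    exact this
  have hS : (ShortComplex.mk f g w).ShortExact :=
    ShortComplex.ShortExact.mk' ((ShortComplex.moduleCat_exact_iff_range_eq_ker _).2 hfg)
      ((ModuleCat.mono_iff_injective _).2 hf) ((ModuleCat.epi_iff_surjective _).2 hg)
  obtain ⟨δ, h1, h2, h3⟩ := lc_les a _ hS n
  exact ⟨δ, ex_iff h1, ex_iff h2, ex_iff h3⟩

/-- connecting map is surjective when the middle is injective -/
lemma les_surj (a : Ideal R) {X E Z : ModuleCat.{0} R} [Injective E] (f : X ⟶ E) (g : E ⟶ Z)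
    (hf : Function.Injective f.hom) (hg : Function.Surjective g.hom)
    (hfg : LinearMap.range f.hom = LinearMap.ker g.hom) (n : ℕ) :
    ∃ δ : (localCohomology a n).obj Z ⟶ (localCohomology a (n+1)).obj X,
      LinearMap.range ((localCohomology a n).map g).hom = LinearMap.ker δ.hom ∧ 
      Function.Surjective δ.hom := by
  obtain ⟨δ, h1, h2, -⟩ := les a f g hf hg hfg n
  refine ⟨δ, h1, ?_⟩
  rw [← LinearMap.range_eq_top, h2, eq_top_iff]
  intro x _
  exact zero_of_isZero (lc_injective a E n) _

/-- the δ iso in positive degree -/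
lemma les_iso (a : Ideal R) {X E Z : ModuleCat.{0} R} [Injective E] (f : X ⟶ E) (g : E ⟶ Z)
    (hf : Function.Injective f.hom) (hg : Function.Surjective g.hom)
    (hfg : LinearMap.range f.hom = LinearMap.ker g.hom) (n : ℕ) :
    Nonempty ((localCohomology a (n+1)).obj Z ≅ (localCohomology a (n+2)).obj X) := by
  obtain ⟨δ, h1, h2⟩ := les_surj a f g hf hg hfg (n+1)
  have hinj : Function.Injective δ.hom := by
    rw [← LinearMap.ker_eq_bot, ← h1, eq_bot_iff]
    rintro _ ⟨y, rfl⟩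
    rw [zero_of_isZero (lc_injective a E n) y, map_zero]
    exact Submodule.zero_mem _
  have := (ModuleCat.mono_iff_injective δ).2 hinj
  have := (ModuleCat.epi_iff_surjective δ).2 h2
  have := isIso_of_mono_of_epi δ
  exact ⟨asIso δ⟩

lemma isArtinian_of_iso {X Y : ModuleCat.{0} R} (e : X ≅ Y) (h : IsArtinian R Y) : IsArtinian R X :=
  isArtinian_of_linearEquiv e.toLinearEquiv.symm

lemma exists_ses (X : ModuleCat.{0} R) : ∃ (E Z : ModuleCat.{0} R) (_ : Injective E) (f : X ⟶ E)
    (g : E ⟶ Z), Function.Injective f.hom ∧ Function.Surjective g.hom ∧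
      LinearMap.range f.hom = LinearMap.ker g.hom := by
  refine ⟨Injective.under X, ModuleCat.of R ((Injective.under X : ModuleCat.{0} R) ⧸ LinearMap.range (Injective.ι X).hom),
    inferInstance, Injective.ι X, ModuleCat.ofHom (Submodule.mkQ _),
    (ModuleCat.mono_iff_injective _).1 inferInstance, Submodule.mkQ_surjective _, ?_⟩
  exact (Submodule.ker_mkQ _).symm

/-- splitting of the low degree sequence -/
lemma low (b : Ideal R) {X E Z : ModuleCat.{0} R} [Injective E] (f : X ⟶ E) (g : E ⟶ Z)
    (hf : Function.Injective f.hom) (hg : Function.Surjective g.hom)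
    (hfg : LinearMap.range f.hom = LinearMap.ker g.hom) :
    ∃ (C : ModuleCat.{0} R) (p : (localCohomology b 0).obj E ⟶ C)
      (i : C ⟶ (localCohomology b 0).obj Z)
      (q : (localCohomology b 0).obj Z ⟶ (localCohomology b 1).obj X),
      p ≫ i = (localCohomology b 0).map g ∧
      Function.Injective ((localCohomology b 0).map f).hom ∧ Function.Surjective p.hom ∧
      LinearMap.range ((localCohomology b 0).map f).hom = LinearMap.ker p.hom ∧
      Function.Injective i.hom ∧ Function.Surjective q.hom ∧
      LinearMap.range i.hom = LinearMap.ker q.hom := by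
  obtain ⟨_, _, _, h3⟩ := les b f g hf hg hfg 0
  obtain ⟨q, h1, h2⟩ := les_surj b f g hf hg hfg 0
  let G := ((localCohomology b 0).map g).hom
  refine ⟨ModuleCat.of R (LinearMap.range G), ModuleCat.ofHom G.rangeRestrict,
    ModuleCat.ofHom (LinearMap.range G).subtype, q, rfl, gamma_map_inj b f hf,
    LinearMap.surjective_rangeRestrict _, ?_, Subtype.val_injective, h2, ?_⟩
  · rw [h3]
    exact (LinearMap.ker_rangeRestrict G).symm
  · rw [← h1]
    exact Submodule.range_subtype _

lemma art_step {A B C D K : Type} [AddCommGroup A] [AddCommGroup B] [AddCommGroup C] [AddCommGroup D]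
    [AddCommGroup K] [Module R A] [Module R B] [Module R C] [Module R D] [Module R K]
    (i : A →ₗ[R] B) (q : B →ₗ[R] C) (d : A →ₗ[R] D) (θ : B →ₗ[R] K) [IsArtinian R C] [IsArtinian R D]
    (h1 : LinearMap.range i = LinearMap.ker q)
    (h2 : ∀ x, d x = 0 → θ (i x) = 0) (hθ : Function.Surjective θ) : IsArtinian R K := by
  have hA : IsArtinian R (A ⧸ LinearMap.ker d) :=
    isArtinian_of_injective ((LinearMap.ker d).liftQ d le_rfl)
      (LinearMap.ker_eq_bot.1 (Submodule.ker_liftQ_eq_bot _ _ _ le_rfl))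
  have hC : IsArtinian R (B ⧸ LinearMap.ker q) :=
    isArtinian_of_injective ((LinearMap.ker q).liftQ q le_rfl)
      (LinearMap.ker_eq_bot.1 (Submodule.ker_liftQ_eq_bot _ _ _ le_rfl))
  let α : (A ⧸ LinearMap.ker d) →ₗ[R] K := (LinearMap.ker d).liftQ (θ ∘ₗ i) h2
  let N := LinearMap.range α
  have hN : IsArtinian R (K ⧸ N) := by
    have hle : LinearMap.ker q ≤ LinearMap.ker (N.mkQ ∘ₗ θ) := by
      intro x hx
      rw [← h1] at hx
      obtain ⟨y, rfl⟩ := hx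
      refine (Submodule.Quotient.mk_eq_zero _).2 ⟨Submodule.Quotient.mk y, rfl⟩
    refine isArtinian_of_surjective (B ⧸ LinearMap.ker q) ((LinearMap.ker q).liftQ _ hle) ?_
    intro y
    obtain ⟨y, rfl⟩ := Submodule.mkQ_surjective _ y
    obtain ⟨x, rfl⟩ := hθ y
    exact ⟨Submodule.Quotient.mk x, rfl⟩
  exact isArtinian_of_range_eq_ker α N.mkQ (Submodule.ker_mkQ N).symm

lemma main_zero (a b : Ideal R) (X : ModuleCat.{0} R)
    (h : IsArtinian R ((localCohomology a 0).obj ((localCohomology b 0).obj X))) :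
    IsArtinian R ((localCohomology (a + b) 0).obj X) := by
  obtain ⟨φ, -, hφ⟩ := lc_comp_surj a b X
  exact isArtinian_of_surjective _ φ.hom hφ

lemma main_one (a b : Ideal R) (X : ModuleCat.{0} R)
    (h0 : IsArtinian R ((localCohomology a 1).obj ((localCohomology b 0).obj X)))
    (h1 : IsArtinian R ((localCohomology a 0).obj ((localCohomology b 1).obj X))) :
    IsArtinian R ((localCohomology (a + b) 1).obj X) := by
  obtain ⟨E, Z, _, f, g, hf, hg, hfg⟩ := exists_ses X
  obtain ⟨C, p, i, q, hpi, k1, k2, k3, k4, k5, k6⟩ := low b f g hf hg hfg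
  obtain ⟨d, d1, -, -⟩ := les a _ p k1 k2 k3 0
  obtain ⟨-, -, -, e3⟩ := les a i q k4 k5 k6 0
  obtain ⟨δ, l1, l2⟩ := les_surj (a + b) f g hf hg hfg 0
  obtain ⟨φ, hφ1, hφ⟩ := lc_comp_surj a b Z
  obtain ⟨ψ, hψ1, hψ⟩ := lc_comp_surj a b E
  have hsq : (localCohomology a 0).map ((localCohomology b 0).map g) ≫ φ =
      ψ ≫ (localCohomology (a+b) 0).map g := by
    have : Mono (eps (a+b) Z) := (ModuleCat.mono_iff_injective _).2 (eps_inj _ _)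
    rw [← cancel_mono (eps (a+b) Z), Category.assoc, Category.assoc, hφ1, eps_nat, reassoc_of% hψ1,
      ← Category.assoc, eps_nat, Category.assoc, eps_nat]
  refine art_step ((localCohomology a 0).map i).hom ((localCohomology a 0).map q).hom d.hom
    (φ ≫ δ).hom e3 ?_ (l2.comp hφ)
  intro x hx
  have hx' : x ∈ LinearMap.range ((localCohomology a 0).map p).hom := by
    rw [d1]; exact hx
  obtain ⟨y, rfl⟩ := hx'
  have e : (localCohomology a 0).map p ≫ (localCohomology a 0).map i ≫ φ = 
      ψ ≫ (localCohomology (a+b) 0).map g := by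
    rw [← hsq, ← hpi, Functor.map_comp, Category.assoc]
  have e' : φ.hom (((localCohomology a 0).map i).hom (((localCohomology a 0).map p).hom y)) =
    ((localCohomology (a+b) 0).map g).hom (ψ.hom y) := congrArg (fun t => t.hom y) e
  have : ((localCohomology (a+b) 0).map g).hom (ψ.hom y) ∈ LinearMap.ker δ.hom := by
    rw [← l1]; exact ⟨_, rfl⟩
  rw [← e'] at this
  exact this

lemma main_succ [IsNoetherianRing R] (a b : Ideal R) (s : ℕ)
    (ih : ∀ (X : ModuleCat.{0} R), (∀ r, r ≤ s + 1 →
      IsArtinian R ((localCohomology a (s + 1 - r)).obj ((localCohomology b r).obj X))) →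
      IsArtinian R ((localCohomology (a + b) (s + 1)).obj X)) (X : ModuleCat.{0} R)
    (h : ∀ r, r ≤ s + 2 →
      IsArtinian R ((localCohomology a (s + 2 - r)).obj ((localCohomology b r).obj X))) :
    IsArtinian R ((localCohomology (a + b) (s + 2)).obj X) := by
  obtain ⟨E, Z, _, f, g, hf, hg, hfg⟩ := exists_ses X
  obtain ⟨δ, l1, l2⟩ := les_surj (a + b) f g hf hg hfg (s + 1)
  suffices IsArtinian R ((localCohomology (a + b) (s + 1)).obj Z) from
    isArtinian_of_surjective _ δ.hom l2
  apply ih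
  intro r hr
  match r with
  | 0 =>
    obtain ⟨C, p, i, q, hpi, k1, k2, k3, k4, k5, k6⟩ := low b f g hf hg hfg
    have := gamma_injective b E
    obtain ⟨e⟩ := les_iso a _ p k1 k2 k3 s
    have hC : IsArtinian R ((localCohomology a (s + 1)).obj C) :=
      isArtinian_of_iso e (h 0 (Nat.zero_le _))
    obtain ⟨-, -, -, e3⟩ := les a i q k4 k5 k6 (s + 1)
    have hH : IsArtinian R ((localCohomology a (s + 1)).obj ((localCohomology b 1).obj X)) :=
      h 1 (by omega)
    exact isArtinian_of_range_eq_ker _ _ e3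
  | r + 1 =>
    obtain ⟨e⟩ := les_iso b f g hf hg hfg r
    have hh := h (r + 2) (by omega)
    have e1 : s + 2 - (r + 2) = s + 1 - (r + 1) := by omega
    rw [e1] at hh
    exact isArtinian_of_iso ((localCohomology a (s + 1 - (r + 1))).mapIso e) hh

theorem main_thm [IsNoetherianRing R] (a b : Ideal R) (t : ℕ) : ∀ (X : ModuleCat.{0} R), (∀ r, r ≤ t →
      IsArtinian R ((localCohomology a (t - r)).obj ((localCohomology b r).obj X))) →
      IsArtinian R ((localCohomology (a + b) t).obj X) := by
  induction t with
  | zero => exact fun X h => main_zero a b X (h 0 le_rfl)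
  | succ t ih =>
    match t, ih with
    | 0, _ => exact fun X h => main_one a b X (h 0 (Nat.zero_le _)) (h 1 le_rfl)
    | s + 1, ih => exact main_succ a b s ih

end Main

end LCAux

open CategoryTheory

/-- Let `R` be a commutative noetherian ring, `a, b` ideals of `R`, `X` an
`R`-module and `t ≥ 0` such that `H^{t-r}_a(H^r_b(X))` is artinian for all `0 ≤ r ≤ t`.  Then
`H^t_{a+b}(X)` is artinian. -/
theorem statement15 {R : Type} [CommRing R] [IsNoetherianRing R] (a b : Ideal R)
    (X : ModuleCat R) (t : ℕ)
    (h : ∀ r, r ≤ t →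
      IsArtinian R ((localCohomology a (t - r)).obj ((localCohomology b r).obj X))) :
    IsArtinian R ((localCohomology (a + b) t).obj X) := by
  exact LCAux.main_thm a b t X h
end

section
/- Let R be a commutative noetherian ring, let a be an ideal of R, let X be an R-module, let n be a positive integer, and let x₁, ..., xₙ ∈ R be elements such that cd(a + (x₁,...,xₙ), X) = cd(a, X) + n. Then dim_R(H^{cd(a,X)}_a(X)) ≥ n; in particular, H^{cd(a,X)}_a(X) is not artinian. -/
open CategoryTheory

/-- The Krull dimension of an `R`-module `Y`, i.e. the Krull dimension of its support in
`Spec R`. -/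
noncomputable def moduleDim (R : Type) [CommRing R] (Y : Type) [AddCommGroup Y] [Module R Y] :
    WithBot ℕ∞ :=
  Order.krullDim (Module.support R Y)





namespace LC
open Opposite

variable {R : Type} [CommRing R]

lemma homologyπ_eq_zero_iff {S : Type} [Ring S] (K : CochainComplex (ModuleCat.{0} S) ℕ) (i : ℕ) (z : K.cycles i) :
    K.homologyπ i z = 0 ↔ ∃ (j : ℕ) (y : K.X j), K.d j i y = K.iCycles i z := by
  have hex : (ShortComplex.mk (K.toCycles ((ComplexShape.up ℕ).prev i) i) (K.homologyπ i)
    (by simp)).Exact := 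
    ShortComplex.exact_of_g_is_cokernel _ (K.homologyIsCokernel _ i rfl)
  rw [ShortComplex.moduleCat_exact_iff] at hex
  have hinj : Function.Injective (K.iCycles i) := (ModuleCat.mono_iff_injective _).1 inferInstance
  constructor
  · intro h
    obtain ⟨y, hy⟩ := hex z h
    refine ⟨_, y, ?_⟩
    rw [← hy, ← K.toCycles_i]
    rfl
  · rintro ⟨j, y, hy⟩
    have : K.toCycles j i y = z := by
      apply hinj
      rw [← hy, ← K.toCycles_i]
      rfl
    rw [← this, ← ModuleCat.comp_apply]
    simp

lemma exists_cycle {S : Type} [Ring S] (K : CochainComplex (ModuleCat.{0} S) ℕ) (i : ℕ) (g : K.X i)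
    (hg : K.d i (i+1) g = 0) : ∃ z : K.cycles i, K.iCycles i z = g := by
  have hex : (ShortComplex.mk (K.iCycles i) (K.d i (i+1)) (by simp)).Exact := 
    ShortComplex.exact_of_f_is_kernel _ (K.cyclesIsKernel i (i+1) (by simp))
  rw [ShortComplex.moduleCat_exact_iff] at hex
  exact hex g hg

/-- `e` is the class of the cocycle `g`. -/
def Cls {A X : ModuleCat.{0} R} (P : ProjectiveResolution A) {i : ℕ}
    (e : ((Ext R (ModuleCat.{0} R) i).obj (op A)).obj X) (g : P.complex.X i ⟶ X) : Prop :=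
  ∃ z : (P.complex.linearYonedaObj R X).cycles i,
    (P.complex.linearYonedaObj R X).iCycles i z = g ∧
    (P.isoExt i X).inv ((P.complex.linearYonedaObj R X).homologyπ i z) = e

variable {A X : ModuleCat.{0} R} {P : ProjectiveResolution A} {i : ℕ}
    {e : ((Ext R (ModuleCat.{0} R) i).obj (op A)).obj X} {g : P.complex.X i ⟶ X}

lemma Cls.exists_rep (P : ProjectiveResolution A) (e : ((Ext R (ModuleCat.{0} R) i).obj (op A)).obj X) :
    ∃ g, Cls P e g := by
  have hs : Function.Surjective ((P.complex.linearYonedaObj R X).homologyπ i) :=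
    (ModuleCat.epi_iff_surjective _).1 inferInstance
  obtain ⟨z, hz⟩ := hs ((P.isoExt i X).hom e)
  exact ⟨_, z, rfl, by rw [hz]; simp⟩

lemma Cls.exists_class (P : ProjectiveResolution A) (g : P.complex.X i ⟶ X)
    (hg : P.complex.d (i+1) i ≫ g = 0) :
    ∃ e, Cls P e g := by
  obtain ⟨z, hz⟩ := exists_cycle (P.complex.linearYonedaObj R X) i g hg
  exact ⟨_, z, hz, rfl⟩

lemma Cls.d_comp (h : Cls P e g) (j : ℕ) : P.complex.d j i ≫ g = 0 := by
  obtain ⟨z, rfl, -⟩ := h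
  have := ConcreteCategory.congr_hom ((P.complex.linearYonedaObj R X).iCycles_d i j) z
  exact this

lemma Cls.smul (h : Cls P e g) (r : R) : Cls P (r • e) (r • g) := by
  obtain ⟨z, rfl, rfl⟩ := h
  exact ⟨r • z, by simp; rfl, by simp⟩

lemma Cls.eq_zero_iff (h : Cls P e g) : e = 0 ↔ ∃ (j : ℕ) (g' : P.complex.X j ⟶ X), 
    P.complex.d i j ≫ g' = g := by
  obtain ⟨z, rfl, rfl⟩ := h
  have : (P.isoExt i X).inv ((P.complex.linearYonedaObj R X).homologyπ i z) = 0 ↔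
    (P.complex.linearYonedaObj R X).homologyπ i z = 0 := by
    constructor
    · intro h
      have := congrArg (P.isoExt i X).hom h
      simpa using this
    · intro h; rw [h]; simp
  rw [this, homologyπ_eq_zero_iff]
  simp
  rfl



/-- map on Hom complexes -/
noncomputable def yonMap {P P' : ChainComplex (ModuleCat.{0} R) ℕ} (ψ : P' ⟶ P) (X : ModuleCat.{0} R) :
    P.linearYonedaObj R X ⟶ P'.linearYonedaObj R X :=
  (HomologicalComplex.unopFunctor _ _).map
    ((((linearYoneda R (ModuleCat.{0} R)).obj X).rightOp.mapHomologicalComplex _).map ψ).op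

lemma yonMap_f_apply {P P' : ChainComplex (ModuleCat.{0} R) ℕ} (ψ : P' ⟶ P) (X : ModuleCat.{0} R)
    (i : ℕ) (g : P.X i ⟶ X) : (yonMap ψ X).f i g = (ψ.f i ≫ g : P'.X i ⟶ X) := rfl

lemma inv_aux {V : Type*} [Category V] {a b c d : V} {p : a ≅ b} {q : c ≅ d} {m : b ⟶ d} {k : a ⟶ c}
    (h : p.hom ≫ m = k ≫ q.hom) : m ≫ q.inv = p.inv ≫ k := by
  rw [Iso.eq_inv_comp, ← Category.assoc, Iso.comp_inv_eq, h]

lemma homologyUnop_nat {V : Type*} [Category V] [Abelian V] {K L : HomologicalComplex Vᵒᵖ (ComplexShape.down ℕ)}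
    (φ : K ⟶ L) (i : ℕ) :
    (HomologicalComplex.homologyMap φ i).unop ≫ (K.homologyUnop i).inv =
     (L.homologyUnop i).inv ≫ HomologicalComplex.homologyMap ((HomologicalComplex.unopFunctor _ _).map φ.op) i := by
  have := HomologicalComplex.homologyOp_hom_naturality
    ((HomologicalComplex.unopFunctor V (ComplexShape.down ℕ)).map φ.op) i
  have h2 : (L.homologyUnop i).hom ≫ (HomologicalComplex.homologyMap φ i).unop =
    HomologicalComplex.homologyMap ((HomologicalComplex.unopFunctor _ _).map φ.op) i ≫
      (K.homologyUnop i).hom := congrArg Quiver.Hom.unop this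
  exact inv_aux h2

lemma comp_aux {V : Type*} [Category V] {a b c d e f : V} {E : a ⟶ b} {a' : b ⟶ c} {b' : c ⟶ d}
    {p : a ⟶ e} {q : e ⟶ f} {m : f ⟶ d} {k : e ⟶ c} (h1 : E ≫ a' = p ≫ k) (h2 : k ≫ b' = q ≫ m) :
    E ≫ (a' ≫ b') = (p ≫ q) ≫ m := by
  rw [← Category.assoc, h1, Category.assoc, h2, Category.assoc]

lemma isoExt_nat {A A' X : ModuleCat.{0} R} (P : ProjectiveResolution A) (P' : ProjectiveResolution A')
    (φ : A' ⟶ A) (ψ : P'.complex ⟶ P.complex) (comm : ψ.f 0 ≫ P.π.f 0 = P'.π.f 0 ≫ φ) (i : ℕ) :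
    ((Ext R (ModuleCat.{0} R) i).map φ.op).app X ≫ (P'.isoExt i X).hom =
      (P.isoExt i X).hom ≫ HomologicalComplex.homologyMap (yonMap ψ X) i := by
  have h := ProjectiveResolution.isoLeftDerivedObj_inv_naturality φ P' P ψ comm
    ((linearYoneda R (ModuleCat.{0} R)).obj X).rightOp i
  have h' := congrArg Quiver.Hom.unop h
  have h2 := homologyUnop_nat ((((linearYoneda R (ModuleCat.{0} R)).obj X).rightOp.mapHomologicalComplex _).map ψ) i
  exact comp_aux h' h2

lemma Cls.map {A A' X : ModuleCat.{0} R} {P : ProjectiveResolution A} {P' : ProjectiveResolution A'}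
    {e : ((Ext R (ModuleCat.{0} R) i).obj (op A)).obj X} {g : P.complex.X i ⟶ X} (h : Cls P e g)
    (φ : A' ⟶ A) (ψ : P'.complex ⟶ P.complex) (comm : ψ.f 0 ≫ P.π.f 0 = P'.π.f 0 ≫ φ) :
    Cls P' (((Ext R (ModuleCat.{0} R) i).map φ.op).app X e) (ψ.f i ≫ g) := by
  obtain ⟨z, rfl, rfl⟩ := h
  refine ⟨HomologicalComplex.cyclesMap (yonMap ψ X) i z, ?_, ?_⟩
  · have := ConcreteCategory.congr_hom (HomologicalComplex.cyclesMap_i (yonMap ψ X) i) z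
    exact this
  · have h1 := ConcreteCategory.congr_hom (HomologicalComplex.homologyπ_naturality (yonMap ψ X) i) z
    have h2 := isoExt_nat (X := X) P P' φ ψ comm i
    rw [← Iso.inv_comp_eq, ← Category.assoc, ← Iso.eq_comp_inv] at h2
    have h3 := ConcreteCategory.congr_hom h2 (((P.complex.linearYonedaObj R X).homologyπ i) z)
    simp only [ModuleCat.comp_apply] at h1 h3
    rw [← h1]
    exact h3.symm


lemma injExtMk_eq_zero_iff {A X : ModuleCat.{0} R} (I : InjectiveResolution X) {i : ℕ}
    (f : A ⟶ I.cocomplex.X i) (hf : f ≫ I.cocomplex.d i (i+1) = 0) :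
    I.extMk f (i+1) rfl hf = 0 ↔ ∃ (j : ℕ) (g : A ⟶ I.cocomplex.X j), g ≫ I.cocomplex.d j i = f := by
  rcases i with _ | p
  · simp only [← I.extEquivCohomologyClass.apply_eq_iff_eq,
      InjectiveResolution.extEquivCohomologyClass_extMk, InjectiveResolution.extEquivCohomologyClass_zero,
      CochainComplex.HomComplex.CohomologyClass.mk_eq_zero_iff]
    rw [CochainComplex.HomComplex.Cocycle.fromSingleMk_mem_coboundaries_iff _ _ _ _ _ (-1) (by lia)]
    have hz : Limits.IsZero (I.cochainComplex.X (-1)) := I.cochainComplex.isZero_of_isStrictlyGE 0 (-1)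
    constructor
    · rintro ⟨g, hg⟩
      rw [hz.eq_of_tgt g 0, Limits.zero_comp] at hg
      refine ⟨0, 0, ?_⟩
      rw [← cancel_mono (I.cochainComplexXIso 0 0 rfl).inv]
      simpa using hg
    · rintro ⟨j, g, hg⟩
      rw [I.cocomplex.shape j 0 (by simp), Limits.comp_zero] at hg
      exact ⟨0, by simp [← hg]⟩
  · rw [I.extMk_eq_zero_iff f _ rfl hf p rfl]
    constructor
    · rintro ⟨g, hg⟩; exact ⟨p, g, hg⟩
    · rintro ⟨j, g, hg⟩
      by_cases hj : j + 1 = p + 1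
      · obtain rfl : j = p := by omega
        exact ⟨g, hg⟩
      · rw [I.cocomplex.shape j (p+1) (by simpa using hj), Limits.comp_zero] at hg
        exact ⟨0, by simp [← hg]⟩

lemma projExtMk_eq_zero_iff {A X : ModuleCat.{0} R} (P : ProjectiveResolution A) {i : ℕ}
    (f : P.complex.X i ⟶ X) (hf : P.complex.d (i+1) i ≫ f = 0) :
    P.extMk f (i+1) rfl hf = 0 ↔ ∃ (j : ℕ) (g : P.complex.X j ⟶ X), P.complex.d i j ≫ g = f := by
  rcases i with _ | p
  · simp only [← P.extEquivCohomologyClass.apply_eq_iff_eq,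
      ProjectiveResolution.extEquivCohomologyClass_extMk, ProjectiveResolution.extEquivCohomologyClass_zero,
      CochainComplex.HomComplex.CohomologyClass.mk_eq_zero_iff]
    rw [CochainComplex.HomComplex.Cocycle.toSingleMk_mem_coboundaries_iff _ _ _ _ _ (1) (by simp)]
    have hz : Limits.IsZero (P.cochainComplex.X (1)) := P.cochainComplex.isZero_of_isStrictlyLE 0 (1)
    constructor
    · rintro ⟨g, hg⟩
      rw [hz.eq_of_src g 0, Limits.comp_zero] at hg
      refine ⟨0, 0, ?_⟩
      rw [← cancel_epi (P.cochainComplexXIso 0 0 rfl).hom]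
      simpa using hg
    · rintro ⟨j, g, hg⟩
      rw [P.complex.shape 0 j (by simp), Limits.zero_comp] at hg
      exact ⟨0, by simp [← hg]⟩
  · rw [P.extMk_eq_zero_iff f _ rfl hf p rfl]
    constructor
    · rintro ⟨g, hg⟩; exact ⟨p, g, hg⟩
    · rintro ⟨j, g, hg⟩
      by_cases hj : j + 1 = p + 1
      · obtain rfl : j = p := by omega
        exact ⟨g, hg⟩
      · rw [P.complex.shape (p+1) j (by simpa using hj), Limits.zero_comp] at hg
        exact ⟨0, by simp [← hg]⟩

/-- `e` in `Ext^i(A,X)` is represented by the cocycle `f : A ⟶ I^i`. -/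
def Comp {A X : ModuleCat.{0} R} (I : InjectiveResolution X) {i : ℕ}
    (e : ((Ext R (ModuleCat.{0} R) i).obj (op A)).obj X) (f : A ⟶ I.cocomplex.X i) : Prop :=
  ∃ (g : (projectiveResolution A).complex.X i ⟶ X) (hg : (projectiveResolution A).complex.d (i+1) i ≫ g = 0)
    (hf : f ≫ I.cocomplex.d i (i+1) = 0), Cls (projectiveResolution A) e g ∧
    (projectiveResolution A).extMk g (i+1) rfl hg = I.extMk f (i+1) rfl hf

section
variable {A X : ModuleCat.{0} R} {I : InjectiveResolution X} {i : ℕ}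
    {e : ((Ext R (ModuleCat.{0} R) i).obj (op A)).obj X} {f : A ⟶ I.cocomplex.X i}

lemma Comp.d (h : Comp I e f) : f ≫ I.cocomplex.d i (i+1) = 0 := by
  obtain ⟨_, _, h, _⟩ := h; exact h

lemma Comp.exists_rep (I : InjectiveResolution X) (e : ((Ext R (ModuleCat.{0} R) i).obj (op A)).obj X) :
    ∃ f, Comp I e f := by
  obtain ⟨g, hg⟩ := Cls.exists_rep (projectiveResolution A) e
  obtain ⟨f, hf, hfe⟩ := I.extMk_surjective ((projectiveResolution A).extMk g (i+1) rfl (hg.d_comp _)) (i+1) rfl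
  exact ⟨f, g, hg.d_comp _, hf, hg, hfe.symm⟩

lemma Comp.exists_class (I : InjectiveResolution X) (f : A ⟶ I.cocomplex.X i)
    (hf : f ≫ I.cocomplex.d i (i+1) = 0) : ∃ e, Comp I e f := by
  obtain ⟨g, hg, hge⟩ := (projectiveResolution A).extMk_surjective (I.extMk f (i+1) rfl hf) (i+1) rfl
  obtain ⟨e, he⟩ := Cls.exists_class _ g hg
  exact ⟨e, g, hg, hf, he, hge⟩

lemma Comp.eq_zero_iff (h : Comp I e f) :
    e = 0 ↔ ∃ (j : ℕ) (g : A ⟶ I.cocomplex.X j), g ≫ I.cocomplex.d j i = f := by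
  obtain ⟨g, hg, hf, hc, he⟩ := h
  rw [← injExtMk_eq_zero_iff I f hf, ← he, projExtMk_eq_zero_iff, hc.eq_zero_iff]

lemma Comp.smul (h : Comp I e f) (r : R) : Comp I (r • e) (r • f) := by
  obtain ⟨g, hg, hf, hc, he⟩ := h
  refine ⟨r • g, by simp [hg], by simp [hf], hc.smul r, ?_⟩
  have h1 := (projectiveResolution A).extMk_comp_mk₀ g (i+1) rfl hg (r • 𝟙 X)
  have h2 := I.mk₀_comp_extMk f (i+1) rfl hf (r • 𝟙 A)
  simp only [Linear.comp_smul, Linear.smul_comp, Category.comp_id, Category.id_comp,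
    Abelian.Ext.mk₀_smul, Abelian.Ext.comp_smul, Abelian.Ext.smul_comp, Abelian.Ext.comp_mk₀_id,
    Abelian.Ext.mk₀_id_comp] at h1 h2
  rw [← h1, ← h2, he]

lemma Comp.map (h : Comp I e f) {A' : ModuleCat.{0} R} (φ : A' ⟶ A) :
    Comp I (((Ext R (ModuleCat.{0} R) i).map φ.op).app X e) (φ ≫ f) := by
  obtain ⟨g, hg, hf, hc, he⟩ := h
  let ψ : ProjectiveResolution.Hom (projectiveResolution A') (projectiveResolution A) φ :=
    { hom := ProjectiveResolution.lift φ _ _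
      hom_f_zero_comp_π_f_zero := by simpa using ProjectiveResolution.lift_commutes_zero φ _ _ }
  have h1 := ProjectiveResolution.mk₀_comp_extMk g (i+1) rfl hg ψ
  have h2 := I.mk₀_comp_extMk f (i+1) rfl hf φ
  refine ⟨ψ.hom.f i ≫ g, by rw [← ψ.hom.comm_assoc, hg, Limits.comp_zero], by simp [hf], 
    hc.map φ ψ.hom (ProjectiveResolution.lift_commutes_zero φ _ _), ?_⟩
  rw [← h1, ← h2, he]

end


/-- `m` in `H^i_a(X)` is represented by the cocycle `y ∈ Γ_a(I^i)`. -/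
def Rel {X : ModuleCat.{0} R} (a : Ideal R) (I : InjectiveResolution X) {i : ℕ}
    (y : I.cocomplex.X i) (m : (localCohomology a i).obj X) : Prop :=
  ∃ (t : ℕ) (e : ((Ext R (ModuleCat.{0} R) i).obj (op (ModuleCat.of R (R ⧸ a ^ t)))).obj X)
    (f : ModuleCat.of R (R ⧸ a ^ t) ⟶ I.cocomplex.X i),
    Comp I e f ∧ f (Ideal.Quotient.mk _ 1) = y ∧
    ((Limits.colimit.ι (localCohomology.diagram (localCohomology.idealPowersDiagram a) i)
      (op (op t))).app X) e = m

/-- The diagram evaluated at X -/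
noncomputable abbrev dia (a : Ideal R) (i : ℕ) (X : ModuleCat.{0} R) : ℕᵒᵖᵒᵖ ⥤ ModuleCat.{0} R :=
  localCohomology.diagram (localCohomology.idealPowersDiagram a) i ⋙ (evaluation _ _).obj X

/-- The colimit cocone evaluated at X -/
noncomputable abbrev coc (a : Ideal R) (i : ℕ) (X : ModuleCat.{0} R) : Limits.Cocone (dia a i X) :=
  ((evaluation _ _).obj X).mapCocone 
    (Limits.colimit.cocone (localCohomology.diagram (localCohomology.idealPowersDiagram a) i))

noncomputable def cocIsColimit (a : Ideal R) (i : ℕ) (X : ModuleCat.{0} R) : Limits.IsColimit (coc a i X) :=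
  Limits.isColimitOfPreserves _ (Limits.colimit.isColimit _)

section
variable {X : ModuleCat.{0} R} {a : Ideal R} {I : InjectiveResolution X} {i : ℕ}
    {y : I.cocomplex.X i} {m : (localCohomology a i).obj X}

lemma quot_hom_ext {t : ℕ} {M : ModuleCat.{0} R} (f g : ModuleCat.of R (R ⧸ a ^ t) ⟶ M)
    (h : f (Ideal.Quotient.mk _ 1) = g (Ideal.Quotient.mk _ 1)) : f = g := by
  apply ModuleCat.hom_ext
  apply Submodule.linearMap_qext
  apply LinearMap.ext_ring
  exact h

lemma quot_hom_exists {t : ℕ} {M : ModuleCat.{0} R} (y : M) (h : ∀ r ∈ a ^ t, r • y = 0) :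
    ∃ f : ModuleCat.of R (R ⧸ a ^ t) ⟶ M, f (Ideal.Quotient.mk _ 1) = y := by
  refine ⟨ModuleCat.ofHom ((a ^ t).liftQ (LinearMap.toSpanSingleton R M y) ?_), ?_⟩
  · intro r hr
    exact h r hr
  · change (LinearMap.toSpanSingleton R M y) 1 = y
    simp

lemma quot_hom_tors {t : ℕ} {M : ModuleCat.{0} R} (f : ModuleCat.of R (R ⧸ a ^ t) ⟶ M) (r : R)
    (hr : r ∈ a ^ t) : r • f (Ideal.Quotient.mk _ 1) = 0 := by
  rw [← map_smul]
  have : r • (Ideal.Quotient.mk (a ^ t) 1) = 0 := by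
    rw [← Ideal.Quotient.mk_eq_mk, ← Submodule.Quotient.mk_smul, Submodule.Quotient.mk_eq_zero]
    simpa using hr
  erw [this]
  simp

lemma Rel.exists_rep (I : InjectiveResolution X) (m : (localCohomology a i).obj X) :
    ∃ y : I.cocomplex.X i, Rel a I y m := by
  obtain ⟨j, e, he⟩ := Limits.Concrete.isColimit_exists_rep (dia a i X) (cocIsColimit a i X) m
  obtain ⟨f, hf⟩ := Comp.exists_rep I (A := ModuleCat.of R (R ⧸ a ^ j.unop.unop)) (i := i) e
  exact ⟨_, j.unop.unop, e, f, hf, rfl, he⟩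

lemma Rel.d (h : Rel a I y m) : I.cocomplex.d i (i+1) y = 0 := by
  obtain ⟨t, e, f, hc, rfl, he⟩ := h
  rw [← ModuleCat.comp_apply, hc.d]
  simp

lemma Rel.tors (h : Rel a I y m) : ∃ t : ℕ, ∀ r ∈ a ^ t, r • y = 0 := by
  obtain ⟨t, e, f, hc, rfl, he⟩ := h
  exact ⟨t, quot_hom_tors f⟩

lemma Rel.exists_class (hd : I.cocomplex.d i (i+1) y = 0) (t : ℕ) (ht : ∀ r ∈ a ^ t, r • y = 0) :
    ∃ m, Rel a I y m := by
  obtain ⟨f, hf⟩ := quot_hom_exists y ht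
  obtain ⟨e, he⟩ := Comp.exists_class I f (by
    apply quot_hom_ext
    rw [ModuleCat.comp_apply, hf, hd]
    simp)
  exact ⟨_, t, e, f, he, hf, rfl⟩

lemma Rel.smul (h : Rel a I y m) (r : R) : Rel a I (r • y) (r • m) := by
  obtain ⟨t, e, f, hc, rfl, rfl⟩ := h
  exact ⟨t, r • e, r • f, hc.smul r, by simp, 
    map_smul (ModuleCat.Hom.hom ((coc a i X).ι.app (op (op t)))) r e⟩

lemma Rel.eq_zero_iff (h : Rel a I y m) : m = 0 ↔
    ∃ (j : ℕ) (w : I.cocomplex.X j) (t : ℕ), (∀ r ∈ a ^ t, r • w = 0) ∧ I.cocomplex.d j i w = y := by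
  obtain ⟨t, e, f, hc, rfl, rfl⟩ := h
  have key : ∀ t' (h : t ≤ t'), Comp I (((dia a i X).map (homOfLE h).op.op : _ ⟶ _) e)
    (((localCohomology.ringModIdeals (localCohomology.idealPowersDiagram a)).map (homOfLE h).op) ≫ f) :=
    fun t' h => hc.map _
  have k2 : ∀ t' (h : t ≤ t'), (((localCohomology.ringModIdeals (localCohomology.idealPowersDiagram a)).map
    (homOfLE h).op) ≫ f) (Ideal.Quotient.mk (a ^ t') 1) = f (Ideal.Quotient.mk _ 1) := fun t' h => rfl
  constructor
  · intro h0
    have h0' : (coc a i X).ι.app (op (op t)) e = (coc a i X).ι.app (op (op t)) 0 := by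
      rw [map_zero]; exact h0
    obtain ⟨k, u, v, huv⟩ := Limits.Concrete.isColimit_exists_of_rep_eq (dia a i X) (cocIsColimit a i X) _ _ h0'
    have hk : t ≤ k.unop.unop := leOfHom u.unop.unop
    have hu : u = (homOfLE hk).op.op := Subsingleton.elim _ _
    have := key _ hk
    rw [map_zero, hu] at huv
    obtain ⟨j, g, hg⟩ := this.eq_zero_iff.1 huv
    refine ⟨j, g (Ideal.Quotient.mk _ 1), k.unop.unop, quot_hom_tors g, ?_⟩
    rw [← k2 _ hk, ← hg]
    rfl
  · rintro ⟨j, w, t', hw, hd⟩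
    let T := max t t'
    obtain ⟨g, hg⟩ := quot_hom_exists (t := T) w (fun r hr => hw r (Ideal.pow_le_pow_right (le_max_right _ _) hr))
    have h1 := (key T (le_max_left _ _)).eq_zero_iff.2 ⟨j, g, by
      apply quot_hom_ext
      refine Eq.trans ?_ (k2 T (le_max_left _ _)).symm
      exact (congrArg (I.cocomplex.d j i) hg).trans hd⟩
    have h2 := ConcreteCategory.congr_hom ((coc a i X).w (homOfLE (le_max_left t t')).op.op) e
    exact h2.symm.trans ((congrArg ((coc a i X).ι.app (op (op T))) h1).trans (map_zero _))
end


lemma divisible [IsNoetherianRing R] (M : ModuleCat.{0} R) [Injective M] (a : Ideal R) (x : R) (t N : ℕ)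
    (w : M) (hw : ∀ r ∈ a ^ t, r • w = 0) :
    ∃ (w' : M) (L : ℕ), (∀ r ∈ a ^ t, r • w' = 0) ∧ x ^ L • x ^ N • w' = x ^ L • w := by
  classical
  -- stabilization
  let J : ℕ →o Ideal R :=
    { toFun := fun k => LinearMap.ker (LinearMap.toSpanSingleton R M (x ^ k • w))
      monotone' := by
        apply monotone_nat_of_le_succ
        intro k r hr
        have hr : r • x ^ k • w = 0 := hr
        change r • x ^ (k+1) • w = 0
        rw [pow_succ', mul_smul, smul_comm, hr, smul_zero] }
  obtain ⟨L, hL⟩ := monotone_stabilizes_iff_noetherian.2 ‹IsNoetherianRing R› J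
  have hL' : ∀ r : R, r • x ^ (L + N) • w = 0 → r • x ^ L • w = 0 := by
    intro r hr
    have h1 : r ∈ J (L + N) := hr
    rw [← hL (L + N) (by omega)] at h1
    exact h1
  -- injectivity: extend along R x^(L+N) → R/a^t
  let K : Ideal R := LinearMap.ker ((a ^ t).mkQ ∘ₗ LinearMap.toSpanSingleton R R (x ^ (L + N)))
  let u : (R ⧸ K) →ₗ[R] (R ⧸ a ^ t) :=
    K.liftQ ((a ^ t).mkQ ∘ₗ LinearMap.toSpanSingleton R R (x ^ (L + N))) le_rfl
  have hu : Function.Injective u := by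
    rw [← LinearMap.ker_eq_bot]
    exact Submodule.ker_liftQ_eq_bot _ _ _ le_rfl
  let v : (R ⧸ K) →ₗ[R] M := K.liftQ (LinearMap.toSpanSingleton R M (x ^ L • w)) (by
    intro r hr
    have h1 : (a ^ t).mkQ (r • x ^ (L + N)) = 0 := hr
    rw [Submodule.mkQ_apply, Submodule.Quotient.mk_eq_zero] at h1
    have h2 := hw _ h1
    rw [smul_eq_mul, mul_smul] at h2
    exact hL' r h2)
  haveI : Mono (ModuleCat.ofHom u) := (ModuleCat.mono_iff_injective _).2 hu
  let E := Injective.factorThru (ModuleCat.ofHom v) (ModuleCat.ofHom u)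
  have hE : ModuleCat.ofHom u ≫ E = ModuleCat.ofHom v := Injective.comp_factorThru _ _
  refine ⟨E (Ideal.Quotient.mk _ 1), L, quot_hom_tors E, ?_⟩
  have h1 := ConcreteCategory.congr_hom hE (K.mkQ 1)
  have h2 : v (K.mkQ 1) = x ^ L • w := by
    change (1 : R) • x ^ L • w = _
    rw [one_smul]
  have h3 : u (K.mkQ 1) = x ^ (L + N) • (a ^ t).mkQ 1 := by
    change (a ^ t).mkQ ((1 : R) • x ^ (L + N)) = _
    rw [← map_smul]; congr 1; simp
  have h4 : E (u (K.mkQ 1)) = v (K.mkQ 1) := h1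
  rw [h3, h2, map_smul] at h4
  rw [← mul_smul, ← pow_add]
  exact h4

lemma tors_sup {M : Type} [AddCommGroup M] [Module R M] {a : Ideal R} {x : R} {t k : ℕ} {v : M}
    (h1 : ∀ r ∈ a ^ t, r • v = 0) (h2 : x ^ k • v = 0) :
    ∀ r ∈ (a ⊔ Ideal.span {x}) ^ (t + k), r • v = 0 := by
  intro r hr
  have := Ideal.sup_pow_add_le_pow_sup_pow hr
  rw [Ideal.span_singleton_pow] at this
  obtain ⟨b, hb, c, hc, rfl⟩ := Submodule.mem_sup.1 this
  obtain ⟨d, rfl⟩ := Ideal.mem_span_singleton'.1 hc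
  rw [add_smul, h1 b hb, mul_smul, h2, smul_zero, add_zero]

lemma support_step [IsNoetherianRing R] (X : ModuleCat.{0} R) (a : Ideal R) (x : R) (i : ℕ)
    (h0 : Subsingleton ((localCohomology a (i+1)).obj X)) (p : PrimeSpectrum R)
    (hp : p ∈ Module.support R ((localCohomology (a ⊔ Ideal.span {x}) (i+1)).obj X)) :
    ∃ q ∈ Module.support R ((localCohomology a i).obj X), q < p := by
  let I := injectiveResolution X
  rw [Module.mem_support_iff'] at hp
  obtain ⟨m, hm⟩ := hp
  obtain ⟨c, hc⟩ := Rel.exists_rep I m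
  obtain ⟨t, ht⟩ := hc.tors
  have hta : ∀ r ∈ a ^ t, r • c = 0 := fun r hr => ht r (Ideal.pow_right_mono le_sup_left t hr)
  have htx : x ^ t • c = 0 :=
    ht _ (Ideal.pow_mem_pow ((le_sup_right : _ ≤ a ⊔ Ideal.span {x}) (Ideal.mem_span_singleton_self x)) t)
  obtain ⟨mc, hmc⟩ := Rel.exists_class hc.d t hta
  -- c = d y
  obtain ⟨y, t1, hy, hyc⟩ : ∃ (y : I.cocomplex.X i) (t1 : ℕ), (∀ r ∈ a ^ t1, r • y = 0) ∧
      I.cocomplex.d i (i+1) y = c := by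
    obtain ⟨j, w, t1, hw, hwc⟩ := hmc.eq_zero_iff.1 (Subsingleton.elim _ _)
    by_cases hj : j = i
    · subst hj; exact ⟨w, t1, hw, hwc⟩
    · rw [I.cocomplex.shape j (i+1) (by simpa using hj)] at hwc
      refine ⟨0, 0, by simp, ?_⟩
      rw [← hwc]; simp
  have hz : I.cocomplex.d i (i+1) (x ^ t • y) = 0 := by rw [map_smul, hyc, htx]
  obtain ⟨mz, hmz⟩ := Rel.exists_class hz t1
    (fun r hr => by rw [smul_comm, hy r hr, smul_zero])
  -- key claim
  have key : ∀ s ∉ p.asIdeal, ∀ k : ℕ, (s * x ^ k) • mz ≠ 0 := by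
    intro s hs k h
    obtain ⟨j, w, t2, hw, hwd⟩ := (hmz.smul (s * x ^ k)).eq_zero_iff.1 h
    obtain ⟨w', L, hw', hL⟩ := divisible (I.cocomplex.X j) a x t2 (k + t) w hw
    apply hm s hs
    rw [(hc.smul s).eq_zero_iff]
    refine ⟨i, s • y - I.cocomplex.d j i w', max t1 t2 + (L + (k + t)), tors_sup ?_ ?_, ?_⟩
    · intro r hr
      rw [smul_sub, smul_comm, hy r (Ideal.pow_le_pow_right (le_max_left _ _) hr), ← map_smul,
        hw' r (Ideal.pow_le_pow_right (le_max_right _ _) hr)]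
      simp
    · rw [pow_add, mul_smul, smul_sub, smul_sub, ← map_smul, ← map_smul, hL, map_smul, hwd,
        ← smul_sub]
      have : x ^ (k + t) • s • y = (s * x ^ k) • x ^ t • y := by
        simp only [← mul_smul]; congr 1; ring
      rw [this, sub_self, smul_zero]
    · rw [map_sub, map_smul, hyc, ← ModuleCat.comp_apply, I.cocomplex.d_comp_d]
      simp
  have hxp : x ∈ p.asIdeal := by
    by_contra hx
    have hx' : x ^ t ∉ p.asIdeal := fun h => hx (p.2.mem_of_pow_mem t h)
    apply hm _ hx'
    rw [(hc.smul (x ^ t)).eq_zero_iff, htx]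
    exact ⟨0, 0, 0, by simp, by simp⟩
  let S : Submonoid R := p.asIdeal.primeCompl ⊔ Submonoid.powers x
  have hdisj : Disjoint ((LinearMap.ker (LinearMap.toSpanSingleton R _ mz) : Ideal R) : Set R) (S : Set R) := by
    rw [Set.disjoint_left]
    intro r hr hrS
    obtain ⟨s, hs, _, ⟨k, rfl⟩, rfl⟩ := Submonoid.mem_sup.1 hrS
    exact key s hs k hr
  obtain ⟨q, hq, hle, hqS⟩ := Ideal.exists_le_prime_disjoint _ S hdisj
  rw [Set.disjoint_left] at hqS
  refine ⟨⟨q, hq⟩, ?_, ?_⟩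
  · rw [Module.mem_support_iff']
    exact ⟨mz, fun r hr h => hr (hle h)⟩
  · refine lt_of_le_of_ne ?_ ?_
    · intro r hr
      by_contra hrp
      exact hqS hr ((le_sup_left : _ ≤ S) hrp)
    · rintro rfl
      exact hqS hxp ((le_sup_right : _ ≤ S) (Submonoid.mem_powers x))

lemma subsingleton_step [IsNoetherianRing R] (X : ModuleCat.{0} R) (a : Ideal R) (x : R) (i : ℕ)
    (h0 : Subsingleton ((localCohomology a (i+1)).obj X)) (h1 : Subsingleton ((localCohomology a i).obj X)) :
    Subsingleton ((localCohomology (a ⊔ Ideal.span {x}) (i+1)).obj X) := by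
  rw [← Module.support_eq_empty_iff (R := R), Set.eq_empty_iff_forall_notMem]
  intro p hp
  obtain ⟨q, hq, -⟩ := support_step X a x i h0 p hp
  rw [Module.support_eq_empty] at hq
  exact hq

lemma chain_step {S T : Set (PrimeSpectrum R)} (hT : ∀ p q, p ≤ q → p ∈ T → q ∈ T)
    (h : ∀ p ∈ S, ∃ q ∈ T, q < p) (l : LTSeries S) : ∃ l' : LTSeries T, l'.length = l.length + 1 := by
  obtain ⟨q, hq, hlt⟩ := h l.head.1 l.head.2
  have hST : ∀ p ∈ S, p ∈ T := fun p hp => by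
    obtain ⟨q, hq, hlt⟩ := h p hp
    exact hT _ _ hlt.le hq
  let l2 : LTSeries T := l.map (fun p => ⟨p.1, hST _ p.2⟩) (fun a b hab => hab)
  exact ⟨l2.cons ⟨q, hq⟩ hlt, by
    change 0 + l.length + 1 = l.length + 1
    omega⟩

lemma main_ind [IsNoetherianRing R] (X : ModuleCat.{0} R) (n : ℕ) : ∀ (x : Fin n → R) (a : Ideal R) (c d : ℕ)
    (_ : d = c + n) (_ : ∀ i, c < i → Subsingleton ((localCohomology a i).obj X)),
    (∀ i, d < i → Subsingleton ((localCohomology (a ⊔ Ideal.span (Set.range x)) i).obj X)) ∧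
    (∀ l : LTSeries (Module.support R ((localCohomology (a ⊔ Ideal.span (Set.range x)) d).obj X)),
      ∃ l' : LTSeries (Module.support R ((localCohomology a c).obj X)), l'.length = l.length + n) := by
  induction n with
  | zero =>
    rintro x a c d rfl h
    have e : a ⊔ Ideal.span (Set.range x) = a := by
      rw [Set.range_eq_empty, Ideal.span_empty, sup_bot_eq]
    rw [e]
    exact ⟨h, fun l => ⟨l, rfl⟩⟩
  | succ n ih =>
    rintro x a c d hd h
    have hx : a ⊔ Ideal.span (Set.range x) =
        (a ⊔ Ideal.span {x 0}) ⊔ Ideal.span (Set.range (Fin.tail x)) := by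
      rw [sup_assoc, ← Ideal.span_union]
      congr 2
      conv_lhs => rw [← Fin.cons_self_tail x, Fin.range_cons]
      rfl
    rw [hx]
    obtain ⟨h1, h2⟩ := ih (Fin.tail x) (a ⊔ Ideal.span {x 0}) (c+1) d (by omega) (by
      intro i hi
      obtain ⟨i, rfl⟩ : ∃ k, i = k + 1 := ⟨i - 1, by omega⟩
      exact subsingleton_step X a (x 0) i (h _ (by omega)) (h _ (by omega)))
    refine ⟨h1, fun l => ?_⟩
    obtain ⟨l1, hl1⟩ := h2 l
    obtain ⟨l2, hl2⟩ := chain_step (fun p q hpq hp => Module.mem_support_mono hpq hp)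
      (fun p hp => support_step X a (x 0) c (h _ (by omega)) p hp) l1
    exact ⟨l2, by omega⟩

lemma bot_vanish (X : ModuleCat.{0} R) (i : ℕ) (hi : 0 < i) :
    Subsingleton ((localCohomology (⊥ : Ideal R) i).obj X) := by
  obtain ⟨k, rfl⟩ : ∃ k, i = k + 1 := ⟨i - 1, by omega⟩
  let I := injectiveResolution X
  refine subsingleton_of_forall_eq 0 fun m => ?_
  obtain ⟨y, hy⟩ := Rel.exists_rep I m
  rw [hy.eq_zero_iff]
  have hex := I.exact_succ k
  rw [ShortComplex.moduleCat_exact_iff] at hex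
  obtain ⟨w, hw⟩ := hex y hy.d
  refine ⟨k, w, 1, ?_, hw⟩
  intro r hr
  have : r = 0 := by simpa using hr
  rw [this, zero_smul]

lemma bdd [IsNoetherianRing R] (X : ModuleCat.{0} R) (a : Ideal R) :
    BddAbove {i : ℕ | Nontrivial ((localCohomology a i).obj X)} := by
  obtain ⟨n, x, hx⟩ := Submodule.fg_iff_exists_fin_generating_family.1 (IsNoetherian.noetherian a)
  have := (main_ind X n x ⊥ 0 n (by omega) (bot_vanish X)).1
  rw [bot_sup_eq, Ideal.span, hx] at this
  refine ⟨n, fun i hi => ?_⟩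
  by_contra hlt
  exact not_subsingleton_iff_nontrivial.2 hi (this i (by omega))

lemma artinian_lt {M : Type} [AddCommGroup M] [Module R M] [IsArtinian R M]
    {p q : PrimeSpectrum R} (hq : q ∈ Module.support R M) (hlt : q < p) : False := by
  rw [Module.mem_support_iff'] at hq
  obtain ⟨m, hm⟩ := hq
  let f := LinearMap.toSpanSingleton R M m
  let J : Ideal R := LinearMap.ker f
  have hJ : J ≤ q.asIdeal := by
    intro r hr
    by_contra h
    exact hm r h hr
  have h1 : IsArtinian R (R ⧸ J) :=
    isArtinian_of_injective (J.liftQ f le_rfl)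
      (LinearMap.ker_eq_bot.1 (Submodule.ker_liftQ_eq_bot _ _ _ le_rfl))
  have h2 : IsArtinian R (R ⧸ q.asIdeal) :=
    isArtinian_of_surjective _ (Submodule.factor hJ) (Submodule.factor_surjective hJ)
  have h3 : IsArtinianRing (R ⧸ q.asIdeal) := isArtinian_of_tower R h2
  have h4 : q.asIdeal.IsMaximal := by
    apply Ideal.Quotient.maximal_of_isField
    exact IsArtinianRing.isField_of_isDomain _
  have : q.asIdeal = p.asIdeal := h4.eq_of_le p.2.ne_top hlt.le
  exact hlt.ne (PrimeSpectrum.ext this)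


end LC

theorem statement17 {R : Type} [CommRing R] [IsNoetherianRing R] (a : Ideal R)
    (X : ModuleCat R) (n : ℕ) (hn : 0 < n) (x : Fin n → R)
    (h : cohDim (a + Ideal.span (Set.range x)) X = cohDim a X + n) :
    (n : WithBot ℕ∞) ≤ moduleDim R ((localCohomology a (cohDim a X)).obj X) ∧
      ¬ IsArtinian R ((localCohomology a (cohDim a X)).obj X) := by
  have hv : ∀ i, cohDim a X < i → Subsingleton ((localCohomology a i).obj X) := by
    intro i hi
    by_contra hns
    have : i ≤ cohDim a X := le_csSup (LC.bdd X a) (not_subsingleton_iff_nontrivial.1 hns)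
    omega
  have hne : Nontrivial ((localCohomology (a ⊔ Ideal.span (Set.range x)) (cohDim a X + n)).obj X) := by
    have hnon : {i : ℕ | Nontrivial ((localCohomology (a + Ideal.span (Set.range x)) i).obj X)}.Nonempty := by
      rw [Set.nonempty_iff_ne_empty]
      intro he
      rw [cohDim, he] at h
      simp at h
      omega
    have := Nat.sSup_mem hnon (LC.bdd X _)
    change cohDim (a + Ideal.span (Set.range x)) X ∈ _ at this
    rw [h] at this
    exact this
  obtain ⟨p, hp⟩ := Module.nonempty_support_of_nontrivial (R := R)
    (M := (localCohomology (a ⊔ Ideal.span (Set.range x)) (cohDim a X + n)).obj X)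
  obtain ⟨l, hl⟩ := (LC.main_ind X n x a _ _ rfl hv).2 (RelSeries.singleton _ ⟨p, hp⟩)
  have hl' : l.length = n := by simpa using hl
  refine ⟨?_, fun hart => ?_⟩
  · have   := Order.LTSeries.length_le_krullDim l
    rw [hl'] at this
    exact this
  · have h01 : l ⟨0, by omega⟩ < l ⟨1, by omega⟩ := l.strictMono (by simp [Fin.lt_def])
    exact LC.artinian_lt (l ⟨0, by omega⟩).2 h01
end
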